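/- arXiv:1212.5099 — 4 statements merged into one kernel-verified Lean document; each statement's English description precedes it below -/
import Mathlib

section
/- Let n ≥ 1 and let u_0 : ℝ^n → ℝ be continuous, compactly supported, with u_0 ≥ 0 and u_0 ≢ 0. Let u(x,t) = α_n ∫_{ℝ^n} f_n(|z|) u_0(x − t^{1/4} z) dz be the solution of the biharmonic heat equation u_t + Δ²u = 0 with initial datum u_0. Then: (i) for every compact set K ⊂ ℝ^n there exists T_K > 0 (depending on u_0) such that u(x,t) > 0 for all x ∈ K and all t ≥ T_K; (ii) there exists τ > 0 (depending on u_0) such that for every t > τ there exists x_t ∈ ℝ^n with u(x_t,t) < 0. -/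
open MeasureTheory Real Filter Topology

noncomputable def besselJ (ν y : ℝ) : ℝ :=
  ∑' k : ℕ, (-1 : ℝ) ^ k * (y / 2) ^ ((2 * k : ℝ) + ν) /
    (Nat.factorial k * Real.Gamma ((k : ℝ) + ν + 1))

noncomputable def fmn (m n : ℕ) (η : ℝ) : ℝ :=
  η ^ ((1 : ℝ) - n) *
    ∫ s in Set.Ioi (0 : ℝ),
      Real.exp (-(s ^ (2 * m))) * (η * s) ^ ((n : ℝ) / 2) *
        besselJ (((n : ℝ) - 2) / 2) (η * s)

/-- coefficients of the normalized Bessel function -/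
noncomputable def phiC (n k : ℕ) : ℝ :=
  (-1 : ℝ) ^ k / (4 ^ k * Nat.factorial k * Real.Gamma ((k : ℝ) + n / 2))

/-- normalized Bessel function -/
noncomputable def Phi (n : ℕ) (y : ℝ) : ℝ := ∑' k : ℕ, phiC n k * y ^ (2 * k)

/-- the profile, up to a constant, extended continuously to the whole line -/
noncomputable def FF (n : ℕ) (η : ℝ) : ℝ :=
  ∫ s in Set.Ioi (0 : ℝ), Real.exp (-(s ^ 4)) * s ^ (n - 1) * Phi n (η * s)

lemma gamma_half_pos (n : ℕ) (hn : 1 ≤ n) (k : ℕ) : 0 < Real.Gamma ((k : ℝ) + n / 2) := by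
  apply Real.Gamma_pos_of_pos
  have : (1 : ℝ) ≤ n := by exact_mod_cast hn
  positivity

lemma phiC_aux (n : ℕ) (hn : 1 ≤ n) (k : ℕ) :
    (Nat.factorial (2 * k) : ℝ) * Real.Gamma ((n : ℝ) / 2) ≤
      4 ^ k * Nat.factorial k * Real.Gamma ((k : ℝ) + n / 2) := by
  have h1 : (1 : ℝ) ≤ n := by exact_mod_cast hn
  induction k with
  | zero => simp
  | succ k ih =>
    have e1 : (Nat.factorial (2 * (k + 1)) : ℝ)
        = 4 * (k + 1) * (k + 1 / 2) * Nat.factorial (2 * k) := by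
      rw [show 2 * (k + 1) = (2 * k + 1) + 1 by ring, Nat.factorial_succ, Nat.factorial_succ]
      push_cast; ring
    have e2 : Real.Gamma (((k + 1 : ℕ) : ℝ) + n / 2)
        = ((k : ℝ) + n / 2) * Real.Gamma ((k : ℝ) + n / 2) := by
      rw [← Real.Gamma_add_one (by positivity)]
      congr 1; push_cast; ring
    rw [e1, e2, Nat.factorial_succ]
    push_cast
    have hG := gamma_half_pos n hn k
    calc 4 * ((k : ℝ) + 1) * (k + 1 / 2) * Nat.factorial (2 * k) * Real.Gamma ((n : ℝ) / 2)
        = 4 * ((k : ℝ) + 1) * (k + 1 / 2) * (Nat.factorial (2 * k) * Real.Gamma ((n : ℝ) / 2)) := by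
          ring
      _ ≤ 4 * ((k : ℝ) + 1) * (k + n / 2) *
          (4 ^ k * Nat.factorial k * Real.Gamma ((k : ℝ) + n / 2)) := by
          gcongr
      _ = _ := by ring

lemma phiC_abs (n : ℕ) (hn : 1 ≤ n) (k : ℕ) :
    |phiC n k| = 1 / (4 ^ k * Nat.factorial k * Real.Gamma ((k : ℝ) + n / 2)) := by
  have hG := gamma_half_pos n hn k
  unfold phiC
  rw [abs_div, abs_pow, abs_neg, abs_one, one_pow, abs_of_pos (by positivity)]

lemma phiC_bound (n : ℕ) (hn : 1 ≤ n) (k : ℕ) :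
    |phiC n k| ≤ (Real.Gamma ((n : ℝ) / 2))⁻¹ / Nat.factorial (2 * k) := by
  have hG := gamma_half_pos n hn k
  have hG0 := gamma_half_pos n hn 0
  simp only [Nat.cast_zero, zero_add] at hG0
  rw [phiC_abs n hn, inv_eq_one_div, div_div]
  apply one_div_le_one_div_of_le (by positivity)
  rw [mul_comm]
  exact phiC_aux n hn k

lemma phi_term (n : ℕ) (hn : 1 ≤ n) (k : ℕ) (y : ℝ) :
    ‖phiC n k * y ^ (2 * k)‖ ≤
      (Real.Gamma ((n : ℝ) / 2))⁻¹ * (y ^ (2 * k) / Nat.factorial (2 * k)) := by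
  rw [norm_mul, Real.norm_eq_abs, Real.norm_eq_abs, abs_of_nonneg (by rw [pow_mul]; positivity : 0 ≤ y ^ (2 * k))]
  have := phiC_bound n hn k
  calc |phiC n k| * y ^ (2 * k) ≤ ((Real.Gamma ((n : ℝ) / 2))⁻¹ / Nat.factorial (2 * k)) * y ^ (2 * k) := by
        apply mul_le_mul_of_nonneg_right this
        rw [pow_mul]; positivity
    _ = _ := by ring

lemma cosh_le_exp_abs' (y : ℝ) : Real.cosh y ≤ Real.exp |y| := by
  rw [Real.cosh_eq]
  have h1 : Real.exp y ≤ Real.exp |y| := Real.exp_le_exp.2 (le_abs_self y)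
  have h2 : Real.exp (-y) ≤ Real.exp |y| := Real.exp_le_exp.2 (neg_le_abs y)
  linarith

lemma Phi_bound (n : ℕ) (hn : 1 ≤ n) (y : ℝ) :
    |Phi n y| ≤ (Real.Gamma ((n : ℝ) / 2))⁻¹ * Real.exp |y| := by
  have hG0 := gamma_half_pos n hn 0
  simp only [Nat.cast_zero, zero_add] at hG0
  have := tsum_of_norm_bounded ((Real.hasSum_cosh y).mul_left (Real.Gamma ((n : ℝ) / 2))⁻¹)
    (fun k => phi_term n hn k y)
  refine this.trans ?_
  gcongr
  exact cosh_le_exp_abs' y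

lemma Phi_continuous (n : ℕ) (hn : 1 ≤ n) : Continuous (Phi n) := by
  have hG0 := gamma_half_pos n hn 0
  simp only [Nat.cast_zero, zero_add] at hG0
  rw [continuous_iff_continuousAt]
  intro x
  have : ContinuousOn (Phi n) (Set.Icc (-(|x| + 1)) (|x| + 1)) := by
    apply continuousOn_tsum (u := fun k => (Real.Gamma ((n : ℝ) / 2))⁻¹ *
      ((|x| + 1) ^ (2 * k) / Nat.factorial (2 * k)))
    · intro i; fun_prop
    · exact ((Real.hasSum_cosh (|x| + 1)).mul_left _).summable
    · intro k y hy
      refine (phi_term n hn k y).trans ?_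
      have : y ^ (2 * k) ≤ (|x| + 1) ^ (2 * k) := by
        rw [pow_mul, pow_mul]
        gcongr ?_ ^ k
        exact sq_le_sq' hy.1 hy.2
      gcongr
  apply this.continuousAt
  apply Icc_mem_nhds
  · linarith [neg_abs_le x]
  · linarith [le_abs_self x]

lemma Phi_zero (n : ℕ) : Phi n 0 = (Real.Gamma ((n : ℝ) / 2))⁻¹ := by
  unfold Phi
  rw [tsum_eq_single 0]
  · simp [phiC]
  · intro k hk
    simp [hk]

lemma bessel_eq (n : ℕ) (hn : 1 ≤ n) (y : ℝ) (hy : 0 < y) :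
    y ^ ((n : ℝ) / 2) * besselJ (((n : ℝ) - 2) / 2) y
      = 2 ^ (1 - (n : ℝ) / 2) * (y ^ (n - 1) * Phi n y) := by
  unfold besselJ Phi
  rw [← tsum_mul_left, ← tsum_mul_left, ← tsum_mul_left]
  congr 1
  ext k
  unfold phiC
  have e1 : (k : ℝ) + ((n : ℝ) - 2) / 2 + 1 = k + n / 2 := by ring
  have e2 : (y / 2) ^ ((2 * k : ℝ) + ((n : ℝ) - 2) / 2)
      = (y ^ (2 * k) / 4 ^ k) * (y ^ (((n : ℝ) - 2) / 2) * 2 ^ (1 - (n : ℝ) / 2)) := by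
    rw [Real.rpow_add (by positivity)]
    congr 1
    · rw [show (2 * k : ℝ) = ((2 * k : ℕ) : ℝ) by push_cast; ring, Real.rpow_natCast, div_pow]
      congr 1
      rw [pow_mul]; norm_num
    · rw [Real.div_rpow hy.le (by norm_num), div_eq_mul_inv, ← Real.rpow_neg (by norm_num)]
      congr 2
      ring
  have e3 : y ^ ((n : ℝ) / 2) * y ^ (((n : ℝ) - 2) / 2) = y ^ (n - 1) := by
    rw [← Real.rpow_add hy, ← Real.rpow_natCast]
    congr 1
    push_cast [hn]; ring
  rw [e1, e2, ← e3]
  have hG := gamma_half_pos n hn k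
  field_simp

lemma fmn_eq (n : ℕ) (hn : 1 ≤ n) (η : ℝ) (hη : 0 < η) :
    fmn 2 n η = 2 ^ (1 - (n : ℝ) / 2) * FF n η := by
  unfold fmn FF
  rw [← integral_const_mul, ← integral_const_mul]
  apply setIntegral_congr_fun measurableSet_Ioi
  intro s hs
  have hs : 0 < s := hs
  simp only
  rw [mul_assoc (Real.exp _), bessel_eq n hn _ (by positivity), mul_pow]
  have : η ^ ((1 : ℝ) - n) * η ^ (n - 1) = 1 := by
    rw [← Real.rpow_natCast, ← Real.rpow_add hη]
    push_cast [hn]; simp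
  norm_num only
  linear_combination (Real.exp (-s ^ 4) * (2 ^ (1 - (n : ℝ) / 2) * (s ^ (n - 1) * Phi n (η * s)))) * this

lemma gauss_int (b : ℝ) (hb : 0 < b) (m : ℕ) :
    IntegrableOn (fun s : ℝ => s ^ m * Real.exp (-b * s ^ 2)) (Set.Ioi 0) := by
  have := integrableOn_rpow_mul_exp_neg_mul_sq hb (s := (m : ℝ)) (by linarith [(m.cast_nonneg : (0:ℝ) ≤ m)])
  simpa only [Real.rpow_natCast] using this

/-- domination for the quartic exponential -/
lemma quart_int (R b : ℝ) (m : ℕ) :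
    IntegrableOn (fun s : ℝ => s ^ m * Real.exp (-(s ^ 4) + R * s + b * s ^ 2)) (Set.Ioi 0) := by
  set B := (b + 3) / 2 with hB
  have h := (gauss_int 1 one_pos m).const_mul (Real.exp (B ^ 2 + R ^ 2 / 8))
  refine Integrable.mono' h ?_ ?_
  · exact (Continuous.aestronglyMeasurable (by fun_prop))
  · filter_upwards [ae_restrict_mem measurableSet_Ioi] with s hs
    have hs : 0 < s := hs
    rw [Real.norm_of_nonneg (by positivity), mul_left_comm, ← Real.exp_add]
    refine mul_le_mul_of_nonneg_left (Real.exp_le_exp.2 ?_) (by positivity)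
    have hb : b = 2 * B - 3 := by rw [hB]; ring
    rw [hb]
    nlinarith [sq_nonneg (s ^ 2 - B), sq_nonneg (s - R / 4)]

lemma FF_continuous (n : ℕ) (hn : 1 ≤ n) : Continuous (FF n) := by
  have hP := Phi_continuous n hn
  have hG0 := gamma_half_pos n hn 0
  simp only [Nat.cast_zero, zero_add] at hG0
  rw [continuous_iff_continuousAt]
  intro x
  apply continuousAt_of_dominated (bound := fun s => (Real.Gamma ((n : ℝ) / 2))⁻¹ *
    (s ^ (n - 1) * Real.exp (-(s ^ 4) + (|x| + 1) * s + 0 * s ^ 2)))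
  · refine Eventually.of_forall fun η => ?_
    exact Continuous.aestronglyMeasurable (by fun_prop)
  · have : ∀ᶠ η in 𝓝 x, |η| < |x| + 1 :=
      continuous_abs.continuousAt.eventually_lt continuousAt_const (by linarith)
    filter_upwards [this] with η hη
    filter_upwards [ae_restrict_mem measurableSet_Ioi] with s hs
    have hs : 0 < s := hs
    rw [norm_mul, Real.norm_of_nonneg (by positivity), Real.norm_eq_abs]
    calc _ ≤ Real.exp (-(s ^ 4)) * s ^ (n - 1) * ((Real.Gamma ((n : ℝ) / 2))⁻¹ * Real.exp |η * s|) := by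
          gcongr; exact Phi_bound n hn _
      _ ≤ Real.exp (-(s ^ 4)) * s ^ (n - 1) * ((Real.Gamma ((n : ℝ) / 2))⁻¹ * Real.exp ((|x| + 1) * s)) := by
          rw [abs_mul, abs_of_pos hs]
          gcongr
      _ = _ := by
          rw [zero_mul, add_zero, Real.exp_add]; ring
  · exact (quart_int (|x| + 1) 0 (n - 1)).const_mul _
  · refine Eventually.of_forall fun s => ?_
    exact Continuous.continuousAt (by fun_prop)

lemma FF_zero_pos (n : ℕ) (hn : 1 ≤ n) : 0 < FF n 0 := by
  have hG0 := gamma_half_pos n hn 0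
  simp only [Nat.cast_zero, zero_add] at hG0
  unfold FF
  simp only [zero_mul, Phi_zero]
  have hi : IntegrableOn (fun s : ℝ => Real.exp (-(s ^ 4)) * s ^ (n - 1) * (Real.Gamma ((n : ℝ) / 2))⁻¹)
      (Set.Ioi 0) := by
    have := (quart_int 0 0 (n - 1)).mul_const (Real.Gamma ((n : ℝ) / 2))⁻¹
    simpa [mul_comm, IntegrableOn] using this
  rw [setIntegral_pos_iff_support_of_nonneg_ae _ hi]
  · have : Set.Ioi (0:ℝ) ⊆ Function.support (fun s : ℝ => Real.exp (-(s ^ 4)) * s ^ (n - 1) * (Real.Gamma ((n : ℝ) / 2))⁻¹) ∩ Set.Ioi 0 := by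
      intro s hs
      refine ⟨?_, hs⟩
      have hs : 0 < s := hs
      rw [Function.mem_support]
      positivity
    refine lt_of_lt_of_le ?_ (measure_mono this)
    simp
  · filter_upwards [ae_restrict_mem measurableSet_Ioi] with s hs
    have hs : 0 < s := hs
    simp only [Pi.zero_apply]
    positivity

lemma gauss_moment (μ : ℝ) (hμ : 0 < μ) (m : ℕ) :
    ∫ x in Set.Ioi (0 : ℝ), x ^ m * Real.exp (-μ ^ 2 * x ^ 2)
      = (μ ^ (m + 1))⁻¹ * (1 / 2) * Real.Gamma (((m : ℝ) + 1) / 2) := by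
  have h := integral_rpow_mul_exp_neg_mul_rpow (p := 2) (q := (m : ℝ)) (b := μ ^ 2) (by norm_num)
    (by linarith [(m.cast_nonneg : (0:ℝ) ≤ m)]) (by positivity)
  simp only [Real.rpow_natCast, Real.rpow_two] at h
  rw [h]
  congr 2
  rw [← Real.rpow_natCast μ 2, ← Real.rpow_mul hμ.le, ← Real.rpow_natCast, ← Real.rpow_neg hμ.le]
  congr 1
  push_cast; ring

lemma gauss_term (n : ℕ) (hn : 1 ≤ n) (μ : ℝ) (hμ : 0 < μ) (k : ℕ) :
    ∫ x in Set.Ioi (0 : ℝ), x ^ (2 * k + (n - 1)) * Real.exp (-μ ^ 2 * x ^ 2)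
      = (μ ^ n)⁻¹ * (1 / 2) * (μ ^ (2 * k))⁻¹ * Real.Gamma ((k : ℝ) + n / 2) := by
  rw [gauss_moment μ hμ]
  have e1 : 2 * k + (n - 1) + 1 = 2 * k + n := by omega
  have e2 : (((2 * k + (n - 1) : ℕ) : ℝ) + 1) / 2 = (k : ℝ) + n / 2 := by
    push_cast [hn]; ring
  rw [e1, e2, pow_add, mul_inv]
  ring

lemma gauss_transform (n : ℕ) (hn : 1 ≤ n) (μ : ℝ) (hμ : 0 < μ) (s : ℝ) :
    ∫ x in Set.Ioi (0 : ℝ), x ^ (n - 1) * Real.exp (-μ ^ 2 * x ^ 2) * Phi n (x * s)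
      = (μ ^ n)⁻¹ * (1 / 2) * Real.exp (-(s ^ 2 / (4 * μ ^ 2))) := by
  have hint : ∀ k : ℕ, Integrable (fun x : ℝ => phiC n k * s ^ (2 * k) *
      (x ^ (2 * k + (n - 1)) * Real.exp (-μ ^ 2 * x ^ 2))) (volume.restrict (Set.Ioi 0)) := by
    intro k
    exact (gauss_int (μ ^ 2) (by positivity) _).const_mul _
  have hval : ∀ k : ℕ, ∀ c : ℝ, ∫ x in Set.Ioi (0 : ℝ), c * s ^ (2 * k) *
      (x ^ (2 * k + (n - 1)) * Real.exp (-μ ^ 2 * x ^ 2)) = c * s ^ (2 * k) *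
      ((μ ^ n)⁻¹ * (1 / 2) * (μ ^ (2 * k))⁻¹ * Real.Gamma ((k : ℝ) + n / 2)) := by
    intro k c
    rw [integral_const_mul, gauss_term n hn μ hμ]
  have hsum : Summable fun k : ℕ => ∫ x in Set.Ioi (0 : ℝ), ‖phiC n k * s ^ (2 * k) *
      (x ^ (2 * k + (n - 1)) * Real.exp (-μ ^ 2 * x ^ 2))‖ := by
    have : ∀ k : ℕ, ∫ x in Set.Ioi (0 : ℝ), ‖phiC n k * s ^ (2 * k) *
      (x ^ (2 * k + (n - 1)) * Real.exp (-μ ^ 2 * x ^ 2))‖ = ((μ ^ n)⁻¹ * (1 / 2)) *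
        ((s ^ 2 / (4 * μ ^ 2)) ^ k / Nat.factorial k) := by
      intro k
      have : ∫ x in Set.Ioi (0 : ℝ), ‖phiC n k * s ^ (2 * k) *
        (x ^ (2 * k + (n - 1)) * Real.exp (-μ ^ 2 * x ^ 2))‖ = ∫ x in Set.Ioi (0 : ℝ), |phiC n k| * s ^ (2 * k) *
        (x ^ (2 * k + (n - 1)) * Real.exp (-μ ^ 2 * x ^ 2)) := by
        apply setIntegral_congr_fun measurableSet_Ioi
        intro x hx
        have hx : 0 < x := hx
        simp only
        rw [norm_mul, norm_mul, Real.norm_eq_abs, Real.norm_of_nonneg (by rw [pow_mul]; positivity),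
          Real.norm_of_nonneg (by positivity)]
      rw [this, hval, phiC_abs n hn]
      have hG := gamma_half_pos n hn k
      rw [div_pow, mul_pow, pow_mul, pow_mul]
      field_simp
    simp_rw [this]
    exact (Real.summable_pow_div_factorial _).mul_left _
  have h := hasSum_integral_of_summable_integral_norm hint hsum
  have h2 : HasSum (fun k : ℕ => ((μ ^ n)⁻¹ * (1 / 2)) *
        ((-(s ^ 2 / (4 * μ ^ 2))) ^ k / Nat.factorial k))
      ((μ ^ n)⁻¹ * (1 / 2) * Real.exp (-(s ^ 2 / (4 * μ ^ 2)))) := by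
    apply HasSum.mul_left
    rw [Real.exp_eq_exp_ℝ]
    exact NormedSpace.expSeries_div_hasSum_exp _
  have h3 := h.unique (h2.congr_fun ?_)
  · rw [← h3]
    apply integral_congr_ae
    refine Eventually.of_forall fun x => ?_
    simp only [Phi]
    rw [← tsum_mul_left]
    congr 1
    ext k
    rw [mul_pow, pow_add]; ring
  · intro k
    rw [hval]
    unfold phiC
    have hG := gamma_half_pos n hn k
    rw [neg_pow (s ^ 2 / (4 * μ ^ 2)), div_pow, mul_pow, pow_mul, pow_mul]
    field_simp

lemma fubini_int (n : ℕ) (hn : 1 ≤ n) (μ : ℝ) (hμ : 0 < μ) :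
    Integrable (Function.uncurry fun x s : ℝ => x ^ (n - 1) * Real.exp (-μ ^ 2 * x ^ 2) *
      (Real.exp (-(s ^ 4)) * s ^ (n - 1) * Phi n (x * s)))
      ((volume.restrict (Set.Ioi 0)).prod (volume.restrict (Set.Ioi 0))) := by
  have hP := Phi_continuous n hn
  have hG0 := gamma_half_pos n hn 0
  simp only [Nat.cast_zero, zero_add] at hG0
  have h1 := gauss_int (μ ^ 2 / 2) (by positivity) (n - 1)
  have h2 := quart_int 0 (1 / (2 * μ ^ 2)) (n - 1)
  have h := (Integrable.mul_prod h1 h2).const_mul (Real.Gamma ((n : ℝ) / 2))⁻¹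
  refine Integrable.mono' h ?_ ?_
  · apply Continuous.aestronglyMeasurable
    unfold Function.uncurry
    fun_prop
  · rw [Measure.prod_restrict]
    filter_upwards [ae_restrict_mem (measurableSet_Ioi.prod measurableSet_Ioi)] with z hz
    obtain ⟨x, s⟩ := z
    have hx : 0 < x := hz.1
    have hs : 0 < s := hz.2
    simp only [Function.uncurry]
    rw [norm_mul, norm_mul _ (Phi n _), Real.norm_of_nonneg (by positivity),
      Real.norm_of_nonneg (by positivity), Real.norm_eq_abs]
    have hb := Phi_bound n hn (x * s)
    rw [abs_of_pos (by positivity : 0 < x * s)] at hb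
    have key : Real.exp (-μ ^ 2 * x ^ 2) * Real.exp (-(s ^ 4)) * Real.exp (x * s) ≤
        Real.exp (-(μ ^ 2 / 2) * x ^ 2) * Real.exp (-(s ^ 4) + 0 * s + 1 / (2 * μ ^ 2) * s ^ 2) := by
      rw [← Real.exp_add, ← Real.exp_add, ← Real.exp_add]
      apply Real.exp_le_exp.2
      have : 0 ≤ (μ * x - s / μ) ^ 2 := sq_nonneg _
      have e : (μ * x - s / μ) ^ 2 = μ ^ 2 * x ^ 2 - 2 * (x * s) + 2 * (1 / (2 * μ ^ 2) * s ^ 2) := by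
        field_simp
        ring
      linarith
    calc _ ≤ x ^ (n - 1) * Real.exp (-μ ^ 2 * x ^ 2) *
      (Real.exp (-(s ^ 4)) * s ^ (n - 1) * ((Real.Gamma ((n : ℝ) / 2))⁻¹ * Real.exp (x * s))) := by
          gcongr
      _ = (Real.Gamma ((n : ℝ) / 2))⁻¹ * (x ^ (n - 1) * s ^ (n - 1)) *
          (Real.exp (-μ ^ 2 * x ^ 2) * Real.exp (-(s ^ 4)) * Real.exp (x * s)) := by ring
      _ ≤ _ := mul_le_mul_of_nonneg_left key (by positivity)
      _ = _ := by ring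

lemma FF_gauss_int (n : ℕ) (hn : 1 ≤ n) (μ : ℝ) (hμ : 0 < μ) :
    IntegrableOn (fun x => x ^ (n - 1) * Real.exp (-μ ^ 2 * x ^ 2) * FF n x) (Set.Ioi 0) := by
  have := (fubini_int n hn μ hμ).integral_prod_left
  simp only [Function.uncurry, integral_const_mul] at this
  exact this

lemma FF_gauss (n : ℕ) (hn : 1 ≤ n) (μ : ℝ) (hμ : 0 < μ) :
    ∫ x in Set.Ioi (0 : ℝ), x ^ (n - 1) * Real.exp (-μ ^ 2 * x ^ 2) * FF n x
      = 2 ^ n / 2 * ∫ r in Set.Ioi (0 : ℝ), r ^ (n - 1) * Real.exp (-(16 * μ ^ 4 * r ^ 4) - r ^ 2) := by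
  have h := integral_integral_swap (fubini_int n hn μ hμ)
  simp only [integral_const_mul] at h
  unfold FF
  rw [h]
  have h1 : ∀ s : ℝ, ∫ x in Set.Ioi (0 : ℝ), x ^ (n - 1) * Real.exp (-μ ^ 2 * x ^ 2) *
      (Real.exp (-(s ^ 4)) * s ^ (n - 1) * Phi n (x * s)) =
      (μ ^ n)⁻¹ * (1 / 2) * (Real.exp (-(s ^ 4)) * s ^ (n - 1) * Real.exp (-(s ^ 2 / (4 * μ ^ 2)))) := by
    intro s
    have : ∀ x : ℝ, x ^ (n - 1) * Real.exp (-μ ^ 2 * x ^ 2) *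
      (Real.exp (-(s ^ 4)) * s ^ (n - 1) * Phi n (x * s)) = (Real.exp (-(s ^ 4)) * s ^ (n - 1)) *
      (x ^ (n - 1) * Real.exp (-μ ^ 2 * x ^ 2) * Phi n (x * s)) := fun x => by ring
    simp_rw [this]
    rw [integral_const_mul, gauss_transform n hn μ hμ]
    ring
  simp_rw [h1]
  rw [integral_const_mul]
  have h2 := integral_comp_mul_left_Ioi (fun s : ℝ => Real.exp (-(s ^ 4)) * s ^ (n - 1) *
    Real.exp (-(s ^ 2 / (4 * μ ^ 2)))) 0 (b := 2 * μ) (by positivity)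
  rw [mul_zero, smul_eq_mul] at h2
  have h3 : ∀ r : ℝ, Real.exp (-((2 * μ * r) ^ 4)) * (2 * μ * r) ^ (n - 1) *
    Real.exp (-((2 * μ * r) ^ 2 / (4 * μ ^ 2))) = (2 * μ) ^ (n - 1) *
      (r ^ (n - 1) * Real.exp (-(16 * μ ^ 4 * r ^ 4) - r ^ 2)) := by
    intro r
    have e : Real.exp (-(16 * μ ^ 4 * r ^ 4) - r ^ 2) = Real.exp (-((2 * μ * r) ^ 4)) *
        Real.exp (-((2 * μ * r) ^ 2 / (4 * μ ^ 2))) := by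
      rw [← Real.exp_add]
      congr 1
      field_simp
      ring
    rw [e, mul_pow]
    ring
  simp_rw [h3] at h2
  rw [integral_const_mul] at h2
  have h4 : ∀ A B : ℝ, (2 * μ) ^ (n - 1) * A = (2 * μ)⁻¹ * B → B = (2 * μ) ^ n * A := by
    intro A B hAB
    obtain ⟨m, rfl⟩ : ∃ m, n = m + 1 := ⟨n - 1, by omega⟩
    simp only [Nat.add_sub_cancel] at hAB
    rw [pow_succ, mul_assoc, mul_left_comm, hAB]
    field_simp
  rw [h4 _ _ h2, mul_pow]
  field_simp

lemma FF_neg (n : ℕ) (hn : 1 ≤ n) : ∃ η, 0 < η ∧ FF n η < 0 := by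
  by_contra hcon
  push Not at hcon
  have hFc := FF_continuous n hn
  set Q : ℝ → ℝ := fun x => x ^ (n + 1) * Real.exp (-4 * x ^ 2) * FF n x with hQ
  have hexp4 : ∀ x : ℝ, 3 * (x ^ 2) * Real.exp (-4 * x ^ 2) ≤
      Real.exp (-x ^ 2) - Real.exp (-4 * x ^ 2) := by
    intro x
    have e : Real.exp (-x ^ 2) = Real.exp (-4 * x ^ 2) * Real.exp (3 * x ^ 2) := by
      rw [← Real.exp_add]; ring_nf
    rw [e]
    have := Real.add_one_le_exp (3 * x ^ 2)
    nlinarith [Real.exp_pos (-4 * x ^ 2)]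
  have hpow : ∀ x : ℝ, x ^ (n + 1) = x ^ (n - 1) * x ^ 2 := by
    intro x; rw [← pow_add]; congr 1; omega
  -- integrability of Q
  have hQi : IntegrableOn Q (Set.Ioi 0) := by
    have h1 := FF_gauss_int n hn 1 one_pos
    refine Integrable.mono' h1 (Continuous.aestronglyMeasurable (by fun_prop)) ?_
    filter_upwards [ae_restrict_mem measurableSet_Ioi] with x hx
    have hx : 0 < x := hx
    have hF := hcon x hx
    rw [hQ, Real.norm_of_nonneg (by positivity)]
    simp only
    rw [hpow]
    have := hexp4 x
    have h5 := Real.exp_pos (-4 * x ^ 2)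
    have h6 : x ^ 2 * Real.exp (-4 * x ^ 2) ≤ Real.exp (-1 ^ 2 * x ^ 2) := by
      rw [show (-1 ^ 2 * x ^ 2 : ℝ) = - x ^ 2 by ring]
      nlinarith [mul_pos (pow_pos hx 2) h5]
    rw [mul_assoc (x ^ (n - 1))]
    gcongr
  have hPpos : 0 < ∫ x in Set.Ioi (0 : ℝ), Q x := by
    rw [setIntegral_pos_iff_support_of_nonneg_ae _ hQi]
    · have hev : ∀ᶠ x in 𝓝 (0 : ℝ), 0 < FF n x :=
        hFc.continuousAt.eventually (lt_mem_nhds (FF_zero_pos n hn))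
      obtain ⟨δ, hδ, hball⟩ := Metric.eventually_nhds_iff.1 hev
      have : Set.Ioo 0 δ ⊆ Function.support Q ∩ Set.Ioi 0 := by
        intro x hx
        refine ⟨?_, hx.1⟩
        have hx0 := hx.1
        have := hball (y := x) (by rw [Real.dist_eq, sub_zero, abs_of_pos hx.1]; exact hx.2)
        rw [Function.mem_support, hQ]
        positivity
      refine lt_of_lt_of_le ?_ (measure_mono this)
      simp [hδ]
    · filter_upwards [ae_restrict_mem measurableSet_Ioi] with x hx
      have hx : 0 < x := hx
      have hF := hcon x hx
      simp only [Pi.zero_apply, hQ]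
      positivity
  set P := ∫ x in Set.Ioi (0 : ℝ), Q x with hP
  set M := ∫ r in Set.Ioi (0 : ℝ), r ^ (n + 3) * Real.exp (-1 * r ^ 2) with hM
  have hM0 : 0 ≤ M := by
    apply setIntegral_nonneg measurableSet_Ioi
    intro r hr
    have hr : 0 < r := hr
    positivity
  have hri : ∀ c : ℝ, 0 ≤ c → IntegrableOn (fun r : ℝ => r ^ (n - 1) * Real.exp (-(16 * c ^ 4 * r ^ 4) - r ^ 2))
      (Set.Ioi 0) := by
    intro c hc
    refine Integrable.mono' (gauss_int 1 one_pos (n - 1)) (Continuous.aestronglyMeasurable (by fun_prop)) ?_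
    filter_upwards [ae_restrict_mem measurableSet_Ioi] with r hr
    have hr : 0 < r := hr
    rw [Real.norm_of_nonneg (by positivity)]
    refine mul_le_mul_of_nonneg_left (Real.exp_le_exp.2 ?_) (by positivity)
    have : 0 ≤ 16 * c ^ 4 * r ^ 4 := by positivity
    linarith
  have hmain : ∀ μ : ℝ, 0 < μ → μ ≤ 1 → 3 * μ ^ 2 * P ≤ 2 ^ n / 2 * (256 * μ ^ 4 * M) := by
    intro μ hμ hμ1
    have h1 := FF_gauss_int n hn μ hμ
    have h2 := FF_gauss_int n hn (2 * μ) (by positivity)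
    have lhs : 3 * μ ^ 2 * P ≤
        (∫ x in Set.Ioi (0 : ℝ), x ^ (n - 1) * Real.exp (-μ ^ 2 * x ^ 2) * FF n x) -
        ∫ x in Set.Ioi (0 : ℝ), x ^ (n - 1) * Real.exp (-(2 * μ) ^ 2 * x ^ 2) * FF n x := by
      rw [← integral_sub h1 h2, hP, ← integral_const_mul]
      apply setIntegral_mono_on (hQi.const_mul _) (h1.sub h2) measurableSet_Ioi
      intro x hx
      have hx : 0 < x := hx
      have hF := hcon x hx
      rw [hQ]
      simp only
      have h3 := hexp4 (μ * x)
      have h4 : Real.exp (-4 * x ^ 2) ≤ Real.exp (-4 * (μ * x) ^ 2) := by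
        apply Real.exp_le_exp.2
        have : (μ * x) ^ 2 ≤ x ^ 2 := by
          apply pow_le_pow_left₀ (by positivity)
          nlinarith
        linarith
      have h5 : 3 * μ ^ 2 * x ^ 2 * Real.exp (-4 * x ^ 2) ≤
          Real.exp (-μ ^ 2 * x ^ 2) - Real.exp (-(2 * μ) ^ 2 * x ^ 2) := by
        rw [show -μ ^ 2 * x ^ 2 = - (μ * x) ^ 2 by ring,
          show -(2 * μ) ^ 2 * x ^ 2 = -4 * (μ * x) ^ 2 by ring]
        refine le_trans ?_ h3
        rw [show 3 * μ ^ 2 * x ^ 2 = 3 * (μ * x) ^ 2 by ring]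
        gcongr
      rw [hpow, Pi.sub_apply]
      have h6 := mul_le_mul_of_nonneg_left h5 (by positivity : 0 ≤ x ^ (n - 1) * FF n x)
      linarith
    refine lhs.trans ?_
    rw [FF_gauss n hn μ hμ, FF_gauss n hn (2 * μ) (by positivity), ← mul_sub,
      ← integral_sub (hri μ hμ.le) (hri (2 * μ) (by positivity)), hM, ← integral_const_mul (256 * μ ^ 4)]
    refine mul_le_mul_of_nonneg_left ?_ (by positivity)
    apply setIntegral_mono_on ((hri μ hμ.le).sub (hri (2 * μ) (by positivity)))
      ((gauss_int 1 one_pos (n + 3)).const_mul _) measurableSet_Ioi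
    intro r hr
    have hr : 0 < r := hr
    rw [Pi.sub_apply]
    have e1 : Real.exp (-(16 * μ ^ 4 * r ^ 4) - r ^ 2) ≤ Real.exp (-1 * r ^ 2) := by
      apply Real.exp_le_exp.2
      have : 0 ≤ 16 * μ ^ 4 * r ^ 4 := by positivity
      linarith
    have e2 : Real.exp (-(16 * (2 * μ) ^ 4 * r ^ 4) - r ^ 2) =
        Real.exp (-1 * r ^ 2) * Real.exp (-(256 * μ ^ 4 * r ^ 4)) := by
      rw [← Real.exp_add]; ring_nf
    have e3 := Real.add_one_le_exp (-(256 * μ ^ 4 * r ^ 4))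
    have e4 := mul_le_mul_of_nonneg_left e3 (Real.exp_pos (-1 * r ^ 2)).le
    have e5 : r ^ (n + 3) = r ^ (n - 1) * r ^ 4 := by
      rw [← pow_add]; congr 1; omega
    rw [e5, ← mul_sub, e2]
    calc _ ≤ r ^ (n - 1) * (256 * μ ^ 4 * r ^ 4 * Real.exp (-1 * r ^ 2)) := by
          refine mul_le_mul_of_nonneg_left ?_ (by positivity)
          linarith
      _ = _ := by ring
  set C := 2 ^ n / 2 * (256 * M) with hC
  have hC0 : 0 ≤ C := by positivity
  have hden : 0 < P + C := by linarith
  have hμ : 0 < P / (P + C) := by positivity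
  have hμ1 : P / (P + C) ≤ 1 := by rw [div_le_one hden]; linarith
  have h := hmain _ hμ hμ1
  set μ := P / (P + C) with hμd
  have h7 : μ * (P + C) = P := by rw [hμd]; field_simp
  have h8 : 3 * P ≤ C * μ ^ 2 := by
    have : μ ^ 2 * (3 * P) ≤ μ ^ 2 * (C * μ ^ 2) := by
      rw [hC]; linarith
    exact le_of_mul_le_mul_left this (by positivity)
  have h9 : C * μ ^ 2 ≤ C * μ := by
    apply mul_le_mul_of_nonneg_left _ hC0
    nlinarith
  nlinarith [mul_pos hμ hPpos]

lemma sign_lemma (n : ℕ)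
    (u₀ : EuclideanSpace ℝ (Fin n) → ℝ) (hc : Continuous u₀)
    (hpos : ∀ x, 0 ≤ u₀ x) (hne : u₀ ≠ 0) (R : ℝ) (hR : ∀ x, R < ‖x‖ → u₀ x = 0)
    (g : EuclideanSpace ℝ (Fin n) → ℝ) (hg : Continuous g) (x : EuclideanSpace ℝ (Fin n))
    (b : ℝ) (hb : 0 < b) (h : ∀ z, ‖x - b • z‖ ≤ R → 0 < g z) :
    0 < ∫ z, g z * u₀ (x - b • z) := by
  obtain ⟨y, hy⟩ := Function.ne_iff.1 hne
  apply Continuous.integral_pos_of_hasCompactSupport_nonneg_nonzero (x := b⁻¹ • (x - y))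
  · fun_prop
  · apply HasCompactSupport.intro (isCompact_closedBall (b⁻¹ • x) (R / b))
    intro z hz
    rw [hR, mul_zero]
    rw [Metric.mem_closedBall, not_le, div_lt_iff₀ hb, dist_comm, dist_eq_norm] at hz
    have : x - b • z = b • (b⁻¹ • x - z) := by
      rw [smul_sub, smul_inv_smul₀ hb.ne']
    rw [this, norm_smul, Real.norm_of_nonneg hb.le, mul_comm]
    exact hz
  · intro z
    rcases le_or_gt ‖x - b • z‖ R with h1 | h1
    · exact mul_nonneg (h z h1).le (hpos _)
    · simp [hR _ h1]
  · have e : x - b • (b⁻¹ • (x - y)) = y := by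
      rw [smul_inv_smul₀ hb.ne']; abel
    rw [e]
    refine mul_ne_zero (ne_of_gt (h _ ?_)) hy
    rw [e]
    by_contra hcon
    exact hy (hR y (not_le.1 hcon))

lemma root_large (A t : ℝ) (hA : 0 ≤ A) (ht : A ^ 4 + 1 ≤ t) : A < t ^ ((1 : ℝ) / 4) := by
  have ht0 : 0 ≤ t := le_trans (by positivity) ht
  have h4 : (t ^ ((1 : ℝ) / 4)) ^ 4 = t := by
    rw [← Real.rpow_natCast, ← Real.rpow_mul ht0]
    norm_num
  refine lt_of_pow_lt_pow_left₀ 4 (by positivity) ?_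
  rw [h4]; linarith

/-- eventual local positivity, and persistent negativity somewhere, for the
biharmonic heat flow with a nonnegative nontrivial compactly supported continuous datum. -/
theorem biharmonic_eventual_local_positivity (n : ℕ) (hn : 1 ≤ n)
    (α : ℝ) (hα : 0 < α)
    (hαdef : α⁻¹ = ∫ x : EuclideanSpace ℝ (Fin n), fmn 2 n ‖x‖)
    (u₀ : EuclideanSpace ℝ (Fin n) → ℝ)
    (hu₀cont : Continuous u₀)
    (hu₀supp : HasCompactSupport u₀)
    (hu₀pos : ∀ x, 0 ≤ u₀ x) (hu₀ne : u₀ ≠ 0)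
    (u : EuclideanSpace ℝ (Fin n) → ℝ → ℝ)
    (hu : ∀ x t, u x t = α * ∫ z : EuclideanSpace ℝ (Fin n),
      fmn 2 n ‖z‖ * u₀ (x - t ^ ((1 : ℝ) / 4) • z)) :
    (∀ K : Set (EuclideanSpace ℝ (Fin n)), IsCompact K →
      ∃ T > (0 : ℝ), ∀ x ∈ K, ∀ t : ℝ, T ≤ t → 0 < u x t) ∧
    (∃ τ > (0 : ℝ), ∀ t : ℝ, τ < t → ∃ x : EuclideanSpace ℝ (Fin n), u x t < 0) := by
  have hFc := FF_continuous n hn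
  haveI : Nonempty (Fin n) := ⟨⟨0, hn⟩⟩
  set c : ℝ := 2 ^ (1 - (n : ℝ) / 2) with hcdef
  have hc : 0 < c := by positivity
  obtain ⟨R, hR0, hR⟩ : ∃ R > 0, ∀ x, R < ‖x‖ → u₀ x = 0 := by
    obtain ⟨R, hR⟩ := hu₀supp.isCompact.isBounded.exists_norm_le
    refine ⟨max R 1, by positivity, fun x hx => ?_⟩
    by_contra hne
    have := hR x (subset_tsupport _ hne)
    exact absurd (le_max_left R 1) (by linarith)
  have hu' : ∀ x t, u x t = α * ∫ z : EuclideanSpace ℝ (Fin n),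
      (c * FF n ‖z‖) * u₀ (x - t ^ ((1 : ℝ) / 4) • z) := by
    intro x t
    rw [hu]
    congr 1
    apply integral_congr_ae
    filter_upwards [compl_mem_ae_iff.2 (measure_singleton (0 : EuclideanSpace ℝ (Fin n)))] with z hz
    rw [fmn_eq n hn ‖z‖ (norm_pos_iff.2 hz)]
  constructor
  · intro K hK
    have hev : ∀ᶠ x in 𝓝 (0 : ℝ), 0 < FF n x :=
      hFc.continuousAt.eventually (lt_mem_nhds (FF_zero_pos n hn))
    obtain ⟨δ, hδ, hball⟩ := Metric.eventually_nhds_iff.1 hev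
    obtain ⟨r, hr⟩ := hK.isBounded.exists_norm_le
    have hr0 : 0 ≤ max r 0 := le_max_right _ _
    refine ⟨((R + max r 0) / δ) ^ 4 + 1, by positivity, fun x hx t ht => ?_⟩
    have hb := root_large _ t (by positivity) ht
    set b := t ^ ((1 : ℝ) / 4) with hbdef
    have hb0 : 0 < b := lt_of_le_of_lt (by positivity) hb
    rw [hu']
    refine mul_pos hα (sign_lemma n u₀ hu₀cont hu₀pos hu₀ne R hR _ (by fun_prop) x b hb0 ?_)
    intro z hz
    refine mul_pos hc (hball ?_)
    rw [Real.dist_eq, sub_zero, abs_norm]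
    have h1 : b * ‖z‖ ≤ R + max r 0 := by
      rw [← Real.norm_of_nonneg hb0.le, ← norm_smul]
      have h2 : ‖b • z‖ ≤ ‖x‖ + ‖x - b • z‖ := by
        have := norm_sub_le x (x - b • z)
        rwa [sub_sub_cancel] at this
      have := (hr x hx).trans (le_max_left r 0)
      linarith
    rw [div_lt_iff₀ hδ] at hb
    exact lt_of_mul_lt_mul_left (lt_of_le_of_lt h1 hb) hb0.le
  · obtain ⟨η, hη, hneg⟩ := FF_neg n hn
    have hev : ∀ᶠ x in 𝓝 η, FF n x < 0 :=
      hFc.continuousAt.eventually (gt_mem_nhds hneg)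
    obtain ⟨δ, hδ, hball⟩ := Metric.eventually_nhds_iff.1 hev
    refine ⟨(R / δ) ^ 4 + 1, by positivity, fun t ht => ?_⟩
    have hb := root_large _ t (by positivity) ht.le
    obtain ⟨z₀, hz₀⟩ : ∃ z₀ : EuclideanSpace ℝ (Fin n), ‖z₀‖ = η :=
      ⟨EuclideanSpace.single ⟨0, hn⟩ η, by simp [abs_of_pos hη]⟩
    set b := t ^ ((1 : ℝ) / 4) with hbdef
    have hb0 : 0 < b := lt_of_le_of_lt (by positivity) hb
    refine ⟨b • z₀, ?_⟩
    rw [hu']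
    have key := sign_lemma n u₀ hu₀cont hu₀pos hu₀ne R hR (fun z => -(c * FF n ‖z‖))
      (by fun_prop) (b • z₀) b hb0 ?_
    · simp only [neg_mul, integral_neg] at key
      exact mul_neg_of_pos_of_neg hα (by simpa only [neg_mul] using neg_pos.1 key)
    · intro z hz
      have hF : FF n ‖z‖ < 0 := by
        apply hball
        rw [← smul_sub, norm_smul, Real.norm_of_nonneg hb0.le] at hz
        rw [div_lt_iff₀ hδ] at hb
        have h1 : ‖z₀ - z‖ < δ := lt_of_mul_lt_mul_left (lt_of_le_of_lt hz hb) hb0.le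
        rw [Real.dist_eq, ← hz₀, abs_sub_comm]
        exact lt_of_le_of_lt (abs_norm_sub_norm_le _ _) h1
      have := mul_neg_of_pos_of_neg hc hF
      linarith
end

section
/- Let n ≥ 1 and β ≥ 0, let g ∈ C_β, set u_0(x) = 1/(g(x) + |x|^β), and let u(x,t) = α_n ∫_{ℝ^n} f_n(|z|) u_0(x − t^{1/4} z) dz be the solution of the biharmonic heat equation u_t + Δ²u = 0 with datum u_0. Then: (i) if β < n, there exists a constant C̃_{n,β} > 0 (depending only on n and β, and in particular not on g or on K) such that for every compact set K ⊂ ℝ^n, t^{β/4} u(x,t) → C̃_{n,β} as t → +∞, uniformly with respect to x ∈ K; (ii) if β ≥ n and g ≡ 1, there exists a constant D̃_{n,β} > 0 such that for every compact set K ⊂ ℝ^n, uniformly in x ∈ K: t^{n/4}(log t)^{-1} u(x,t) → D̃_{n,n} as t → +∞ if β = n, and t^{n/4} u(x,t) → D̃_{n,β} as t → +∞ if β > n. -/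
open MeasureTheory Real Filter Topology

open Asymptotics in
/-- Membership in the class `C_β`: continuous, nonnegative, positive at the origin, and
`g(x) = o(|x|^β)` as `|x| → ∞`. -/
def memCbeta (n : ℕ) (β : ℝ) (g : EuclideanSpace ℝ (Fin n) → ℝ) : Prop :=
  Continuous g ∧ (∀ x, 0 ≤ g x) ∧ 0 < g 0 ∧
    g =o[Filter.comap (fun x : EuclideanSpace ℝ (Fin n) => ‖x‖) Filter.atTop]
      (fun x => ‖x‖ ^ β)

/-- coefficient of the normalized Bessel series -/
noncomputable def bTerm (n : ℕ) (k : ℕ) (y : ℝ) : ℝ :=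
  (-1 : ℝ) ^ k * (y / 2) ^ (2 * k) / (Nat.factorial k * Real.Gamma ((k : ℝ) + (n : ℝ) / 2))

noncomputable def bPhi (n : ℕ) (y : ℝ) : ℝ := ∑' k : ℕ, bTerm n k y

/-- The continuous extension of the profile `f_{2,n}`. -/
noncomputable def bF (n : ℕ) (η : ℝ) : ℝ :=
  (2 : ℝ) ^ (1 - (n : ℝ) / 2) *
    ∫ s in Set.Ioi (0 : ℝ), Real.exp (-(s ^ 4)) * s ^ (n - 1) * bPhi n (η * s)

lemma half_pos_n {n : ℕ} (hn : 1 ≤ n) : (1 : ℝ) / 2 ≤ (n : ℝ) / 2 := by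
  have : (1 : ℝ) ≤ n := by exact_mod_cast hn
  linarith

lemma gamma_lb {n : ℕ} (hn : 1 ≤ n) (k : ℕ) :
    Real.Gamma ((n : ℝ) / 2) * ((2 * k).factorial : ℝ) / 4 ^ k ≤
      (k.factorial : ℝ) * Real.Gamma ((k : ℝ) + (n : ℝ) / 2) := by
  have ha := half_pos_n hn
  induction k with
  | zero => simp
  | succ k ih =>
    have hk : (0 : ℝ) < (k : ℝ) + (n : ℝ) / 2 := by positivity
    have h1 : Real.Gamma (((k + 1 : ℕ) : ℝ) + (n : ℝ) / 2)
        = ((k : ℝ) + (n : ℝ) / 2) * Real.Gamma ((k : ℝ) + (n : ℝ) / 2) := by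
      rw [← Real.Gamma_add_one hk.ne']
      congr 1; push_cast; ring
    rw [h1]
    have h2 : ((2 * (k + 1)).factorial : ℝ) = (2 * k + 2) * (2 * k + 1) * ((2 * k).factorial : ℝ) := by
      rw [show 2 * (k + 1) = (2 * k + 1) + 1 by ring, Nat.factorial_succ, Nat.factorial_succ]
      push_cast; ring
    rw [h2, Nat.factorial_succ]
    push_cast
    have hG : 0 < Real.Gamma ((k : ℝ) + (n : ℝ) / 2) := Real.Gamma_pos_of_pos hk
    have hG' : 0 < Real.Gamma ((n : ℝ) / 2) := Real.Gamma_pos_of_pos (by linarith)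
    calc Real.Gamma ((n : ℝ) / 2) * ((2 * k + 2) * (2 * k + 1) * ((2 * k).factorial : ℝ)) / 4 ^ (k + 1)
        = (((k : ℝ) + 1) * (k + 1 / 2)) * (Real.Gamma ((n : ℝ) / 2) * ((2 * k).factorial : ℝ) / 4 ^ k) := by
          rw [pow_succ]; field_simp; ring
      _ ≤ (((k : ℝ) + 1) * (k + (n : ℝ) / 2)) *
            ((k.factorial : ℝ) * Real.Gamma ((k : ℝ) + (n : ℝ) / 2)) := by
          gcongr
      _ = _ := by ring

lemma bTerm_norm_le {n : ℕ} (hn : 1 ≤ n) (k : ℕ) (y : ℝ) :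
    ‖bTerm n k y‖ ≤ (Real.Gamma ((n : ℝ) / 2))⁻¹ * (y ^ (2 * k) / ((2 * k).factorial : ℝ)) := by
  have ha := half_pos_n hn
  have hG' : 0 < Real.Gamma ((n : ℝ) / 2) := Real.Gamma_pos_of_pos (by linarith)
  have hk : (0 : ℝ) < (k : ℝ) + (n : ℝ) / 2 := by positivity
  have hG : 0 < Real.Gamma ((k : ℝ) + (n : ℝ) / 2) := Real.Gamma_pos_of_pos hk
  have hlb := gamma_lb hn k
  have hf : (0 : ℝ) < (2 * k).factorial := by positivity
  have hy : 0 ≤ y ^ (2 * k) := by rw [pow_mul]; positivity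
  unfold bTerm
  rw [norm_div, norm_mul, norm_pow, norm_neg, norm_one, one_pow, one_mul, norm_pow, Real.norm_eq_abs,
    pow_mul, sq_abs, div_pow, div_pow, ← pow_mul, ← pow_mul, Real.norm_of_nonneg (by positivity),
    div_div]
  have : (Real.Gamma ((n : ℝ) / 2))⁻¹ * (y ^ (2 * k) / ((2 * k).factorial : ℝ)) =
      y ^ (2 * k) / (4 ^ k * (Real.Gamma ((n : ℝ) / 2) * ((2 * k).factorial : ℝ) / 4 ^ k)) := by
    field_simp
  rw [this]
  rw [show (2 : ℝ) ^ (2 * k) = 4 ^ k by rw [pow_mul]; norm_num]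
  gcongr

lemma bTerm_summable_bound {n : ℕ} (y : ℝ) : Summable (fun k : ℕ =>
    (Real.Gamma ((n : ℝ) / 2))⁻¹ * (y ^ (2 * k) / ((2 * k).factorial : ℝ))) :=
  (Real.hasSum_cosh y).summable.mul_left _

lemma bPhi_norm_le {n : ℕ} (hn : 1 ≤ n) (y : ℝ) :
    ‖bPhi n y‖ ≤ (Real.Gamma ((n : ℝ) / 2))⁻¹ * Real.exp |y| := by
  have ha := half_pos_n hn
  have hG' : 0 < Real.Gamma ((n : ℝ) / 2) := Real.Gamma_pos_of_pos (by linarith)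
  have h := tsum_of_norm_bounded ((Real.hasSum_cosh y).mul_left (Real.Gamma ((n : ℝ) / 2))⁻¹)
    (fun k => bTerm_norm_le hn k y)
  refine h.trans ?_
  gcongr
  rw [← Real.cosh_abs, Real.cosh_eq]
  have : Real.exp (-|y|) ≤ Real.exp |y| := Real.exp_le_exp.2 (by linarith [abs_nonneg y])
  linarith

lemma bPhi_continuous {n : ℕ} (hn : 1 ≤ n) : Continuous (bPhi n) := by
  have ha := half_pos_n hn
  have hG' : 0 < Real.Gamma ((n : ℝ) / 2) := Real.Gamma_pos_of_pos (by linarith)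
  rw [continuous_iff_continuousAt]
  intro x
  have : ContinuousOn (bPhi n) (Metric.ball 0 (|x| + 1)) := by
    refine continuousOn_tsum (u := fun k : ℕ => (Real.Gamma ((n : ℝ) / 2))⁻¹ *
      ((|x| + 1) ^ (2 * k) / ((2 * k).factorial : ℝ))) ?_ (bTerm_summable_bound _) ?_
    · intro k
      unfold bTerm
      exact (by fun_prop : Continuous _).continuousOn
    · intro k y hy
      refine (bTerm_norm_le hn k y).trans ?_
      rw [Metric.mem_ball, dist_zero_right, Real.norm_eq_abs] at hy
      have : y ^ (2 * k) ≤ (|x| + 1) ^ (2 * k) := by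
        rw [pow_mul, pow_mul, ← sq_abs y]
        gcongr
      gcongr
  exact this.continuousAt (Metric.isOpen_ball.mem_nhds (by simp))

lemma bPhi_zero_pos {n : ℕ} (hn : 1 ≤ n) : 0 < bPhi n 0 := by
  have ha := half_pos_n hn
  have hG' : 0 < Real.Gamma ((n : ℝ) / 2) := Real.Gamma_pos_of_pos (by linarith)
  have : bPhi n 0 = bTerm n 0 0 := by
    unfold bPhi
    refine tsum_eq_single 0 ?_
    intro k hk
    simp [bTerm, hk]
  rw [this]
  simp [bTerm, hG']

lemma q_integrable (n : ℕ) (M : ℝ) :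
    IntegrableOn (fun s : ℝ => Real.exp (-(s ^ 4)) * s ^ (n - 1) * Real.exp (M * s ^ 2))
      (Set.Ioi 0) := by
  have h1 : IntegrableOn (fun s : ℝ => s ^ (((n - 1 : ℕ)) : ℝ) * Real.exp (-1 * s ^ (2 : ℝ)))
      (Set.Ioi 0) :=
    integrableOn_rpow_mul_exp_neg_mul_rpow (by
      have : (0 : ℝ) ≤ ((n - 1 : ℕ) : ℝ) := by positivity
      linarith) (by norm_num) (by norm_num)
  refine (h1.const_mul (Real.exp ((M + 1) ^ 2 / 4))).mono' ?_ ?_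
  · exact (by fun_prop : Continuous _).aestronglyMeasurable
  · refine (ae_restrict_iff' measurableSet_Ioi).2 (Eventually.of_forall fun s hs => ?_)
    have hs : (0 : ℝ) < s := hs
    rw [Real.norm_of_nonneg (by positivity)]
    rw [Real.rpow_natCast, show (2 : ℝ) = ((2 : ℕ) : ℝ) by norm_num, Real.rpow_natCast]
    have : Real.exp (-(s ^ 4)) * Real.exp (M * s ^ 2) ≤
        Real.exp ((M + 1) ^ 2 / 4) * Real.exp (-1 * s ^ 2) := by
      rw [← Real.exp_add, ← Real.exp_add]
      apply Real.exp_le_exp.2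
      nlinarith [sq_nonneg (s ^ 2 - (M + 1) / 2)]
    calc _ = (Real.exp (-(s ^ 4)) * Real.exp (M * s ^ 2)) * s ^ (n - 1) := by ring
      _ ≤ (Real.exp ((M + 1) ^ 2 / 4) * Real.exp (-1 * s ^ 2)) * s ^ (n - 1) := by gcongr
      _ = _ := by ring

lemma bF_continuous {n : ℕ} (hn : 1 ≤ n) : Continuous (bF n) := by
  have ha := half_pos_n hn
  have hG' : 0 < Real.Gamma ((n : ℝ) / 2) := Real.Gamma_pos_of_pos (by linarith)
  have hc := bPhi_continuous hn
  unfold bF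
  refine continuous_const.mul ?_
  rw [continuous_iff_continuousAt]
  intro x
  refine continuousAt_of_dominated (bound := fun s =>
    ((Real.Gamma ((n : ℝ) / 2))⁻¹ * Real.exp ((|x| + 1) ^ 2)) *
    (Real.exp (-(s ^ 4)) * s ^ (n - 1) * Real.exp (1 * s ^ 2))) ?_ ?_
    ((q_integrable n 1).const_mul _) ?_
  · exact Eventually.of_forall fun y => (by fun_prop : Continuous _).aestronglyMeasurable
  · filter_upwards [Metric.ball_mem_nhds x one_pos] with y hy
    refine (ae_restrict_iff' measurableSet_Ioi).2 (Eventually.of_forall fun s hs => ?_)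
    have hs : (0 : ℝ) < s := hs
    rw [norm_mul, Real.norm_of_nonneg (by positivity : 0 ≤ Real.exp (-(s ^ 4)) * s ^ (n - 1))]
    have hy' : |y| ≤ |x| + 1 := by
      rw [Metric.mem_ball, Real.dist_eq] at hy
      have := abs_sub_abs_le_abs_sub y x
      linarith
    have h1 : ‖bPhi n (y * s)‖ ≤ (Real.Gamma ((n : ℝ) / 2))⁻¹ *
        (Real.exp ((|x| + 1) ^ 2) * Real.exp (1 * s ^ 2)) := by
      refine (bPhi_norm_le hn _).trans ?_
      rw [← Real.exp_add]
      gcongr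
      rw [abs_mul, abs_of_pos hs]
      nlinarith [mul_le_mul_of_nonneg_right hy' hs.le, sq_nonneg (|x| + 1 - s), sq_nonneg (|x| + 1),
        sq_nonneg s]
    calc _ ≤ Real.exp (-(s ^ 4)) * s ^ (n - 1) * ((Real.Gamma ((n : ℝ) / 2))⁻¹ *
        (Real.exp ((|x| + 1) ^ 2) * Real.exp (1 * s ^ 2))) := by gcongr
      _ = _ := by ring
  · exact Eventually.of_forall fun s => (by fun_prop : Continuous _).continuousAt

lemma Ioi_integral_pos {h : ℝ → ℝ} (hi : IntegrableOn h (Set.Ioi 0))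
    (hp : ∀ s, 0 < s → 0 < h s) : 0 < ∫ s in Set.Ioi (0 : ℝ), h s := by
  rw [setIntegral_pos_iff_support_of_nonneg_ae _ hi]
  · have : Function.support h ∩ Set.Ioi 0 = Set.Ioi 0 := by
      apply Set.inter_eq_right.2
      intro s hs
      exact (hp s hs).ne'
    rw [this]; simp
  · exact (ae_restrict_iff' measurableSet_Ioi).2 (Eventually.of_forall fun s hs => (hp s hs).le)

lemma bF_zero_pos {n : ℕ} (hn : 1 ≤ n) : 0 < bF n 0 := by
  unfold bF
  refine mul_pos (by positivity) ?_
  simp only [zero_mul]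
  refine Ioi_integral_pos ?_ ?_
  · have := (q_integrable n 0).mul_const (bPhi n 0)
    simpa [IntegrableOn] using this
  · intro s hs
    have := bPhi_zero_pos hn
    positivity

lemma fmn_eq_bF {n : ℕ} (hn : 1 ≤ n) {η : ℝ} (hη : 0 < η) : fmn 2 n η = bF n η := by
  unfold fmn bF
  rw [← integral_const_mul, ← integral_const_mul]
  refine setIntegral_congr_fun measurableSet_Ioi fun s hs => ?_
  have hs : (0 : ℝ) < s := hs
  have hp : 0 < η * s := by positivity
  have hJ : besselJ (((n : ℝ) - 2) / 2) (η * s) =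
      (η * s / 2) ^ (((n : ℝ) - 2) / 2) * bPhi n (η * s) := by
    unfold besselJ bPhi
    rw [← tsum_mul_left]
    congr 1; ext k
    unfold bTerm
    rw [Real.rpow_add (by positivity), show (2 * (k : ℝ)) = ((2 * k : ℕ) : ℝ) by push_cast; ring,
      Real.rpow_natCast, show (k : ℝ) + ((n : ℝ) - 2) / 2 + 1 = k + (n : ℝ) / 2 by ring]
    ring
  rw [hJ]
  have e1 : (η * s / 2) ^ (((n : ℝ) - 2) / 2) = (η * s) ^ ((n : ℝ) / 2 - 1) * 2 ^ (1 - (n : ℝ) / 2) := by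
    rw [Real.div_rpow hp.le (by norm_num), div_eq_mul_inv, ← Real.rpow_neg (by norm_num)]
    congr 2 <;> ring
  have e2 : (η * s) ^ ((n : ℝ) / 2) * (η * s) ^ ((n : ℝ) / 2 - 1) = η ^ ((n : ℝ) - 1) * s ^ (n - 1) := by
    rw [← Real.rpow_add hp, ← Real.rpow_natCast, Nat.cast_sub hn, Nat.cast_one,
      ← Real.mul_rpow hη.le hs.le]
    congr 1; ring
  have e3 : η ^ ((1 : ℝ) - n) * η ^ ((n : ℝ) - 1) = 1 := by
    rw [← Real.rpow_add hη]; simp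
  rw [e1]
  norm_num
  calc _ = Real.exp (-(s ^ 4)) * 2 ^ (1 - (n : ℝ) / 2) * bPhi n (η * s) * (η ^ ((1 : ℝ) - n) *
        ((η * s) ^ ((n : ℝ) / 2) * (η * s) ^ ((n : ℝ) / 2 - 1))) := by ring
    _ = Real.exp (-(s ^ 4)) * 2 ^ (1 - (n : ℝ) / 2) * bPhi n (η * s) * ((η ^ ((1 : ℝ) - n) *
        η ^ ((n : ℝ) - 1)) * s ^ (n - 1)) := by rw [e2]; ring
    _ = _ := by rw [e3]; ring

lemma gauss_moment_s17 {n : ℕ} (hn : 1 ≤ n) {τ : ℝ} (hτ : 0 < τ) (k : ℕ) :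
    IntegrableOn (fun r : ℝ => r ^ (n - 1) * Real.exp (-τ * r ^ 2) * r ^ (2 * k)) (Set.Ioi 0) ∧
    ∫ r in Set.Ioi (0 : ℝ), r ^ (n - 1) * Real.exp (-τ * r ^ 2) * r ^ (2 * k) =
      1 / 2 * τ ^ (-((n : ℝ) / 2)) * (τ⁻¹) ^ k * Real.Gamma ((k : ℝ) + (n : ℝ) / 2) := by
  have hn' : (1 : ℝ) ≤ n := by exact_mod_cast hn
  have hq : (-1 : ℝ) < ((n - 1 + 2 * k : ℕ) : ℝ) := by
    have : (0 : ℝ) ≤ ((n - 1 + 2 * k : ℕ) : ℝ) := by positivity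
    linarith
  have e : ∀ r : ℝ, r ^ (((n - 1 + 2 * k : ℕ)) : ℝ) * Real.exp (-τ * r ^ (2 : ℝ)) =
      r ^ (n - 1) * Real.exp (-τ * r ^ 2) * r ^ (2 * k) := by
    intro r
    rw [Real.rpow_natCast, Real.rpow_two, pow_add]; ring
  have h1 := integrableOn_rpow_mul_exp_neg_mul_rpow hq (by norm_num : (0 : ℝ) < 2) hτ
  have h2 := integral_rpow_mul_exp_neg_mul_rpow (by norm_num : (0 : ℝ) < 2) hq hτ
  simp only [e] at h1 h2
  refine ⟨h1, ?_⟩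
  rw [h2]
  have e1 : (((n - 1 + 2 * k : ℕ) : ℝ) + 1) / 2 = (k : ℝ) + (n : ℝ) / 2 := by
    push_cast [Nat.cast_sub hn]; ring
  rw [neg_div, e1, neg_add, Real.rpow_add hτ, Real.rpow_neg hτ.le (k : ℝ), Real.rpow_natCast, inv_pow]
  ring

lemma gauss_bPhi {n : ℕ} (hn : 1 ≤ n) {τ : ℝ} (hτ : 0 < τ) (s : ℝ) :
    ∫ r in Set.Ioi (0 : ℝ), r ^ (n - 1) * Real.exp (-τ * r ^ 2) * bPhi n (r * s) =
      1 / 2 * τ ^ (-((n : ℝ) / 2)) * Real.exp (-(s ^ 2 / (4 * τ))) := by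
  have ha := half_pos_n hn
  let c : ℕ → ℝ := fun k => (-1 : ℝ) ^ k * (s / 2) ^ (2 * k) /
    (Nat.factorial k * Real.Gamma ((k : ℝ) + (n : ℝ) / 2))
  let G : ℕ → ℝ → ℝ := fun k r => c k * (r ^ (n - 1) * Real.exp (-τ * r ^ 2) * r ^ (2 * k))
  have hGeq : ∀ k r, G k r = r ^ (n - 1) * Real.exp (-τ * r ^ 2) * bTerm n k (r * s) := by
    intro k r
    simp only [G, c, bTerm]
    rw [show r * s / 2 = r * (s / 2) by ring, mul_pow]
    ring
  have hgam : ∀ k : ℕ, 0 < Real.Gamma ((k : ℝ) + (n : ℝ) / 2) := fun k =>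
    Real.Gamma_pos_of_pos (by positivity)
  have hcJ : ∀ k : ℕ, c k * (1 / 2 * τ ^ (-((n : ℝ) / 2)) * (τ⁻¹) ^ k * Real.Gamma ((k : ℝ) + (n : ℝ) / 2))
      = 1 / 2 * τ ^ (-((n : ℝ) / 2)) * ((-(s ^ 2 / (4 * τ))) ^ k / k.factorial) := by
    intro k
    have := (hgam k).ne'
    have e : (-(s ^ 2 / (4 * τ))) ^ k = (-1) ^ k * (s / 2) ^ (2 * k) * (τ⁻¹) ^ k := by
      rw [pow_mul, ← mul_pow, ← mul_pow]; congr 1; field_simp; ring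
    rw [e]
    simp only [c]
    field_simp
  have hcJ' : ∀ k : ℕ, |c k| * (1 / 2 * τ ^ (-((n : ℝ) / 2)) * (τ⁻¹) ^ k * Real.Gamma ((k : ℝ) + (n : ℝ) / 2))
      = 1 / 2 * τ ^ (-((n : ℝ) / 2)) * ((s ^ 2 / (4 * τ)) ^ k / k.factorial) := by
    intro k
    have h0 : 0 < (1 / 2 * τ ^ (-((n : ℝ) / 2)) * (τ⁻¹) ^ k * Real.Gamma ((k : ℝ) + (n : ℝ) / 2)) := by
      have := hgam k
      positivity
    rw [← abs_of_pos h0, ← abs_mul, hcJ, abs_mul, abs_div, abs_pow, abs_neg,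
      abs_of_nonneg (by positivity : 0 ≤ s ^ 2 / (4 * τ)),
      abs_of_nonneg (by positivity : 0 ≤ 1 / 2 * τ ^ (-((n : ℝ) / 2)))]
    simp
  have hintg : ∀ k, Integrable (G k) (volume.restrict (Set.Ioi 0)) := fun k =>
    ((gauss_moment_s17 hn hτ k).1).const_mul _
  have hnorm : ∀ k, ∫ r in Set.Ioi (0 : ℝ), ‖G k r‖ =
      1 / 2 * τ ^ (-((n : ℝ) / 2)) * ((s ^ 2 / (4 * τ)) ^ k / k.factorial) := by
    intro k
    rw [← hcJ', ← (gauss_moment_s17 hn hτ k).2, ← integral_const_mul]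
    refine setIntegral_congr_fun measurableSet_Ioi fun r hr => ?_
    have hr : (0 : ℝ) < r := hr
    simp only [G]
    rw [norm_mul, Real.norm_eq_abs, Real.norm_of_nonneg (by positivity)]
  have hsum : Summable fun k => ∫ r in Set.Ioi (0 : ℝ), ‖G k r‖ := by
    simp only [hnorm]
    exact (Real.summable_pow_div_factorial _).mul_left _
  have key := hasSum_integral_of_summable_integral_norm hintg hsum
  have hval : ∀ k, ∫ r in Set.Ioi (0 : ℝ), G k r =
      1 / 2 * τ ^ (-((n : ℝ) / 2)) * ((-(s ^ 2 / (4 * τ))) ^ k / k.factorial) := by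
    intro k
    rw [← hcJ, ← (gauss_moment_s17 hn hτ k).2, ← integral_const_mul]
  simp only [hval] at key
  have h2 : HasSum (fun k : ℕ => 1 / 2 * τ ^ (-((n : ℝ) / 2)) *
      ((-(s ^ 2 / (4 * τ))) ^ k / k.factorial))
      (1 / 2 * τ ^ (-((n : ℝ) / 2)) * Real.exp (-(s ^ 2 / (4 * τ)))) := by
    have h3 := NormedSpace.expSeries_div_hasSum_exp (-(s ^ 2 / (4 * τ)))
    rw [← Real.exp_eq_exp_ℝ] at h3
    exact h3.mul_left _
  have h4 := key.unique h2
  rw [← h4]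
  congr 1
  ext r
  simp only [hGeq, bPhi]
  rw [tsum_mul_left]

lemma gauss_bF_pos {n : ℕ} (hn : 1 ≤ n) {τ : ℝ} (hτ : 0 < τ) :
    0 < ∫ r in Set.Ioi (0 : ℝ), r ^ (n - 1) * Real.exp (-τ * r ^ 2) * bF n r := by
  have ha := half_pos_n hn
  have hG' : 0 < Real.Gamma ((n : ℝ) / 2) := Real.Gamma_pos_of_pos (by linarith)
  have hc := bPhi_continuous hn
  let H : ℝ → ℝ → ℝ := fun r s => (r ^ (n - 1) * Real.exp (-τ * r ^ 2)) *
    (Real.exp (-(s ^ 4)) * s ^ (n - 1) * bPhi n (r * s))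
  have hI : Integrable (Function.uncurry H)
      ((volume.restrict (Set.Ioi 0)).prod (volume.restrict (Set.Ioi 0))) := by
    have h1 : IntegrableOn (fun r : ℝ => r ^ (n - 1) * Real.exp (-(τ / 2) * r ^ 2)) (Set.Ioi 0) := by
      have := (gauss_moment_s17 hn (half_pos hτ) 0).1
      simpa using this
    have h2 := q_integrable n (1 / (2 * τ))
    have h3 := (Integrable.mul_prod h1 h2).const_mul (Real.Gamma ((n : ℝ) / 2))⁻¹
    refine h3.mono' ?_ ?_
    · refine (Continuous.aestronglyMeasurable ?_)
      simp only [H, Function.uncurry_def]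
      fun_prop
    · rw [Measure.prod_restrict]
      refine (ae_restrict_iff' (measurableSet_Ioi.prod measurableSet_Ioi)).2
        (Eventually.of_forall fun p hp => ?_)
      obtain ⟨r, s⟩ := p
      have hr : (0 : ℝ) < r := hp.1
      have hs : (0 : ℝ) < s := hp.2
      simp only [Function.uncurry, H]
      have hb : ‖bPhi n (r * s)‖ ≤ (Real.Gamma ((n : ℝ) / 2))⁻¹ *
          Real.exp (τ / 2 * r ^ 2 + 1 / (2 * τ) * s ^ 2) := by
        refine (bPhi_norm_le hn _).trans ?_
        gcongr
        rw [abs_of_pos (by positivity)]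
        have : τ / 2 * r ^ 2 + 1 / (2 * τ) * s ^ 2 - r * s = (τ * r - s) ^ 2 / (2 * τ) := by
          field_simp; ring
        have h0 : 0 ≤ (τ * r - s) ^ 2 / (2 * τ) := by positivity
        linarith
      rw [norm_mul, Real.norm_of_nonneg (by positivity : 0 ≤ r ^ (n - 1) * Real.exp (-τ * r ^ 2)),
        norm_mul, Real.norm_of_nonneg (by positivity : 0 ≤ Real.exp (-(s ^ 4)) * s ^ (n - 1))]
      calc _ ≤ r ^ (n - 1) * Real.exp (-τ * r ^ 2) * (Real.exp (-(s ^ 4)) * s ^ (n - 1) *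
            ((Real.Gamma ((n : ℝ) / 2))⁻¹ * Real.exp (τ / 2 * r ^ 2 + 1 / (2 * τ) * s ^ 2))) := by gcongr
        _ = _ := by
          rw [show -(τ / 2) * r ^ 2 = -τ * r ^ 2 + τ / 2 * r ^ 2 by ring, Real.exp_add, Real.exp_add]
          ring
  have hsw := integral_integral_swap hI
  have e1 : ∫ r in Set.Ioi (0 : ℝ), r ^ (n - 1) * Real.exp (-τ * r ^ 2) * bF n r =
      (2 : ℝ) ^ (1 - (n : ℝ) / 2) * ∫ r in Set.Ioi (0 : ℝ), ∫ s in Set.Ioi (0 : ℝ), H r s := by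
    rw [← integral_const_mul]
    refine integral_congr_ae (Eventually.of_forall fun r => ?_)
    simp only [H, bF]
    rw [integral_const_mul]
    ring
  have e2 : ∀ s, ∫ r in Set.Ioi (0 : ℝ), H r s = (1 / 2 * τ ^ (-((n : ℝ) / 2))) *
      (Real.exp (-(s ^ 4)) * s ^ (n - 1) * Real.exp (-(1 / (4 * τ)) * s ^ 2)) := by
    intro s
    have : ∀ r, H r s = (Real.exp (-(s ^ 4)) * s ^ (n - 1)) *
        (r ^ (n - 1) * Real.exp (-τ * r ^ 2) * bPhi n (r * s)) := by
      intro r; simp only [H]; ring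
    simp only [this]
    rw [integral_const_mul, gauss_bPhi hn hτ, show -(s ^ 2 / (4 * τ)) = -(1 / (4 * τ)) * s ^ 2 by ring]
    ring
  rw [e1, hsw]
  simp only [e2]
  refine mul_pos (by positivity) (Ioi_integral_pos ((q_integrable n _).const_mul _) ?_)
  intro s hs
  positivity

lemma bF_riesz_pos {n : ℕ} (hn : 1 ≤ n) {β : ℝ} (hβ : 0 < β)
    (hI : IntegrableOn (fun r : ℝ => r ^ (n - 1) * (bF n r * r ^ (-β))) (Set.Ioi 0)) :
    0 < ∫ r in Set.Ioi (0 : ℝ), r ^ (n - 1) * (bF n r * r ^ (-β)) := by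
  have hc := bF_continuous hn
  have hGb : 0 < Real.Gamma (β / 2) := Real.Gamma_pos_of_pos (by positivity)
  let H : ℝ → ℝ → ℝ := fun r τ => (r ^ (n - 1) * bF n r) * (τ ^ (β / 2 - 1) * Real.exp (-(r ^ 2 * τ)))
  have hgam : ∀ r : ℝ, 0 < r → ∫ τ in Set.Ioi (0 : ℝ), τ ^ (β / 2 - 1) * Real.exp (-(r ^ 2 * τ)) =
      r ^ (-β) * Real.Gamma (β / 2) := by
    intro r hr
    rw [Real.integral_rpow_mul_exp_neg_mul_Ioi (by positivity) (by positivity)]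
    congr 1
    rw [one_div, Real.inv_rpow (by positivity), ← Real.rpow_neg (by positivity), ← Real.rpow_two,
      ← Real.rpow_mul hr.le]
    congr 1; ring
  have hgi : ∀ r : ℝ, 0 < r → IntegrableOn (fun τ : ℝ => τ ^ (β / 2 - 1) * Real.exp (-(r ^ 2 * τ))) (Set.Ioi 0) := by
    intro r hr
    have := integrableOn_rpow_mul_exp_neg_mul_rpow (s := β / 2 - 1) (by linarith) one_pos
      (by positivity : 0 < r ^ 2)
    simpa using this
  have hH : Integrable (Function.uncurry H)
      ((volume.restrict (Set.Ioi 0)).prod (volume.restrict (Set.Ioi 0))) := by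
    have hm : Measurable (Function.uncurry H) := by
      simp only [H, Function.uncurry_def]
      have := hc.measurable
      fun_prop
    rw [integrable_prod_iff hm.aestronglyMeasurable]
    constructor
    · refine (ae_restrict_iff' measurableSet_Ioi).2 (Eventually.of_forall fun r hr => ?_)
      exact (hgi r hr).const_mul (r ^ (n - 1) * bF n r)
    · refine (hI.norm.mul_const (Real.Gamma (β / 2))).congr ?_
      refine (ae_restrict_iff' measurableSet_Ioi).2 (Eventually.of_forall fun r hr => ?_)
      have hr : (0 : ℝ) < r := hr
      have : ∫ τ in Set.Ioi (0 : ℝ), ‖Function.uncurry H (r, τ)‖ =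
          ∫ τ in Set.Ioi (0 : ℝ), ‖r ^ (n - 1) * bF n r‖ * (τ ^ (β / 2 - 1) * Real.exp (-(r ^ 2 * τ))) := by
        refine setIntegral_congr_fun measurableSet_Ioi fun τ hτ => ?_
        have hτ : (0 : ℝ) < τ := hτ
        simp only [Function.uncurry, H]
        rw [norm_mul, Real.norm_of_nonneg (by positivity : 0 ≤ τ ^ (β / 2 - 1) * Real.exp (-(r ^ 2 * τ)))]
      simp only []
      rw [this, integral_const_mul, hgam r hr, ← mul_assoc, norm_mul, norm_mul,
        Real.norm_of_nonneg (by positivity : 0 ≤ r ^ (-β))]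
      ring
  have hsw := integral_integral_swap hH
  have e1 : ∫ r in Set.Ioi (0 : ℝ), ∫ τ in Set.Ioi (0 : ℝ), H r τ =
      (∫ r in Set.Ioi (0 : ℝ), r ^ (n - 1) * (bF n r * r ^ (-β))) * Real.Gamma (β / 2) := by
    rw [← integral_mul_const]
    refine setIntegral_congr_fun measurableSet_Ioi fun r hr => ?_
    simp only [H]
    rw [integral_const_mul, hgam r hr]
    ring
  have hpos : 0 < ∫ τ in Set.Ioi (0 : ℝ), ∫ r in Set.Ioi (0 : ℝ), H r τ := by
    refine Ioi_integral_pos hH.integral_prod_right ?_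
    intro τ hτ
    have : ∀ r, H r τ = τ ^ (β / 2 - 1) * (r ^ (n - 1) * Real.exp (-τ * r ^ 2) * bF n r) := by
      intro r
      simp only [H]
      rw [show -(r ^ 2 * τ) = -τ * r ^ 2 by ring]; ring
    simp only [this]
    rw [integral_const_mul]
    exact mul_pos (by positivity) (gauss_bF_pos hn hτ)
  rw [← hsw, e1] at hpos
  exact pos_of_mul_pos_left hpos hGb.le

section Kernel

set_option linter.unusedSectionVars false

variable {E : Type*} [NormedAddCommGroup E] [NormedSpace ℝ E] [FiniteDimensional ℝ E]
  [MeasurableSpace E] [BorelSpace E] [Nontrivial E] (μ : Measure E) [μ.IsAddHaarMeasure]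

lemma exists_bound_F {F : ℝ → ℝ} (hFc : Continuous F) :
    ∃ M : ℝ, 0 < M ∧ ∀ v : E, ‖v‖ ≤ 2 → ‖F ‖v‖‖ ≤ M := by
  obtain ⟨M, hM⟩ := (isCompact_Icc (a := (0 : ℝ)) (b := 2)).exists_bound_of_continuousOn
    hFc.continuousOn
  refine ⟨|M| + 1, by positivity, fun v hv => ?_⟩
  have := hM ‖v‖ ⟨norm_nonneg v, hv⟩
  linarith [le_abs_self M]

lemma split_int_aux {F : ℝ → ℝ} (hFc : Continuous F) {h : E → ℝ} (hm : Measurable h)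
    (hb : IntegrableOn h (Metric.ball 0 1) μ) {a : E} :
    IntegrableOn (fun w => F ‖w + a‖ * h w) (Metric.ball 0 1) μ := by
  obtain ⟨M, hM⟩ := (isCompact_closedBall (0 : E) 1).exists_bound_of_continuousOn
    (f := fun w : E => F ‖w + a‖) (by fun_prop)
  refine Integrable.bdd_mul (c := M) hb ?_ ?_
  · exact (by fun_prop : Continuous fun w : E => F ‖w + a‖).aestronglyMeasurable
  · refine (ae_restrict_iff' measurableSet_ball).2 (Eventually.of_forall fun w hw => ?_)
    exact hM w (Metric.ball_subset_closedBall hw)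

lemma far_int_aux {F : ℝ → ℝ} (hF : Integrable (fun z : E => F ‖z‖) μ)
    {h : E → ℝ} (hm : Measurable h) {B : ℝ} (hB0 : 0 ≤ B) (hB : ∀ w, 1 ≤ ‖w‖ → ‖h w‖ ≤ B) (a : E) :
    Integrable (fun z => (Metric.ball (0 : E) 1)ᶜ.indicator h (z - a) * F ‖z‖) μ := by
  refine Integrable.bdd_mul (c := B) hF ?_ ?_
  · exact ((hm.indicator measurableSet_ball.compl).comp
      (measurable_id.sub_const a)).aestronglyMeasurable
  · refine Eventually.of_forall fun z => ?_
    by_cases hz : z - a ∈ (Metric.ball (0 : E) 1)ᶜ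
    · rw [Set.indicator_of_mem hz]
      exact hB _ (by simpa using hz)
    · rw [Set.indicator_of_notMem hz]; simpa using hB0

lemma split_int {F : ℝ → ℝ} (hFc : Continuous F) (hF : Integrable (fun z : E => F ‖z‖) μ)
    {h : E → ℝ} (hm : Measurable h) (hb : IntegrableOn h (Metric.ball 0 1) μ)
    {B : ℝ} (hB0 : 0 ≤ B) (hB : ∀ w, 1 ≤ ‖w‖ → ‖h w‖ ≤ B) (a : E) :
    Integrable (fun z => F ‖z‖ * h (z - a)) μ ∧
    ∫ z, F ‖z‖ * h (z - a) ∂μ = ∫ w in Metric.ball 0 1, F ‖w + a‖ * h w ∂μ +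
      ∫ z, (Metric.ball (0 : E) 1)ᶜ.indicator h (z - a) * F ‖z‖ ∂μ := by
  let G : E → ℝ := (Metric.ball (0 : E) 1).indicator (fun w => F ‖w + a‖ * h w)
  have hG : Integrable G μ :=
    (integrable_indicator_iff measurableSet_ball).2 (split_int_aux μ hFc hm hb)
  have hG2 := hG.comp_sub_right a
  have hfar := far_int_aux μ hF hm hB0 hB a
  have e : ∀ z, F ‖z‖ * h (z - a) =
      G (z - a) + (Metric.ball (0 : E) 1)ᶜ.indicator h (z - a) * F ‖z‖ := by
    intro z
    simp only [G]
    by_cases hz : z - a ∈ Metric.ball (0 : E) 1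
    · rw [Set.indicator_of_mem hz, Set.indicator_of_notMem (by simpa using hz)]
      simp
    · rw [Set.indicator_of_notMem hz, Set.indicator_of_mem (by simpa using hz)]
      ring
  simp only [e]
  refine ⟨hG2.add hfar, ?_⟩
  rw [integral_add hG2 hfar, integral_sub_right_eq_self G a]
  congr 1
  exact integral_indicator measurableSet_ball

lemma kernel_sub {F : ℝ → ℝ} (hFc : Continuous F) (hF : Integrable (fun z : E => F ‖z‖) μ)
    {β : ℝ} (hβ : 0 ≤ β) (hintg : IntegrableOn (fun w : E => ‖w‖ ^ (-β)) (Metric.ball 0 1) μ)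
    {P : Type*} {l : Filter P} [l.IsCountablyGenerated] (h : P → E → ℝ) (a : P → E)
    (ha : Tendsto a l (𝓝 0)) (hm : ∀ p, Measurable (h p))
    (hb : ∀ᶠ p in l, ∀ w, w ≠ 0 → ‖h p w‖ ≤ ‖w‖ ^ (-β))
    (hlim : ∀ (w : P → E) (w0 : E), w0 ≠ 0 → Tendsto w l (𝓝 w0) →
      Tendsto (fun p => h p (w p)) l (𝓝 (‖w0‖ ^ (-β)))) :
    Tendsto (fun p => ∫ z, F ‖z‖ * h p (z - a p) ∂μ) l (𝓝 (∫ z, F ‖z‖ * ‖z‖ ^ (-β) ∂μ)) := by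
  have hne : ∀ᵐ w ∂μ, w ≠ (0 : E) := by
    rw [ae_iff]; simp
  have hsph : ∀ᵐ w ∂μ, ‖w‖ ≠ 1 := by
    rw [ae_iff]
    have := Measure.addHaar_sphere μ (0 : E) 1
    convert this using 2
    ext w; simp
  have hle1 : ∀ w : E, 1 ≤ ‖w‖ → ‖w‖ ^ (-β) ≤ 1 := fun w hw =>
    Real.rpow_le_one_of_one_le_of_nonpos hw (by linarith)
  have hnm : Measurable (fun w : E => ‖w‖ ^ (-β)) := by fun_prop
  have hs0 := (split_int μ hFc hF hnm hintg zero_le_one (fun w hw => by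
    rw [Real.norm_of_nonneg (by positivity)]; exact hle1 w hw) 0).2
  simp only [sub_zero, add_zero] at hs0
  rw [hs0]
  have hev : ∀ᶠ p in l, ∀ w : E, 1 ≤ ‖w‖ → ‖h p w‖ ≤ 1 := by
    filter_upwards [hb] with p hp w hw
    exact (hp w (norm_pos_iff.1 (by linarith))).trans (hle1 w hw)
  have hsplit : ∀ᶠ p in l, ∫ w in Metric.ball 0 1, F ‖w + a p‖ * h p w ∂μ +
      ∫ z, (Metric.ball (0 : E) 1)ᶜ.indicator (h p) (z - a p) * F ‖z‖ ∂μ =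
      ∫ z, F ‖z‖ * h p (z - a p) ∂μ := by
    filter_upwards [hb, hev] with p hp hp1
    refine ((split_int μ hFc hF (hm p) ?_ zero_le_one hp1 (a p)).2).symm
    refine hintg.mono' (hm p).aestronglyMeasurable ?_
    exact ae_restrict_of_ae (hne.mono fun w hw => hp w hw)
  refine Tendsto.congr' hsplit ?_
  have hasmall : ∀ᶠ p in l, ‖a p‖ ≤ 1 := by
    have := ha.norm
    rw [norm_zero] at this
    exact (this.eventually (gt_mem_nhds one_pos)).mono fun p hp => le_of_lt hp
  refine Tendsto.add ?_ ?_
  · obtain ⟨M, hM0, hM⟩ := exists_bound_F (E := E) hFc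
    refine tendsto_integral_filter_of_dominated_convergence (fun w => M * ‖w‖ ^ (-β)) ?_ ?_
      (hintg.const_mul M) ?_
    · refine Eventually.of_forall fun p => ?_
      exact ((by fun_prop : Continuous fun w : E => F ‖w + a p‖).measurable.mul
        (hm p)).aestronglyMeasurable
    · filter_upwards [hb, hasmall] with p hp hap
      refine (ae_restrict_iff' measurableSet_ball).2 (hne.mono fun w hw hwb => ?_)
      rw [norm_mul]
      have h1 : ‖w + a p‖ ≤ 2 := by
        have := norm_add_le w (a p)
        have h3 : ‖w‖ < 1 := by simpa using hwb
        linarith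
      exact mul_le_mul (hM _ h1) (hp w hw) (norm_nonneg _) hM0.le
    · refine ae_restrict_of_ae (hne.mono fun w hw => ?_)
      refine Tendsto.mul ?_ (hlim (fun _ => w) w hw tendsto_const_nhds)
      have h1 : Tendsto (fun p => w + a p) l (𝓝 w) := by
        simpa using tendsto_const_nhds.add ha
      exact (hFc.tendsto _).comp h1.norm
  · refine tendsto_integral_filter_of_dominated_convergence (fun z => 1 * ‖F ‖z‖‖) ?_ ?_
      (hF.norm.const_mul 1) ?_
    · refine Eventually.of_forall fun p => ?_
      exact (((hm p).indicator measurableSet_ball.compl).comp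
        (measurable_id.sub_const (a p))).aestronglyMeasurable.mul hF.aestronglyMeasurable
    · filter_upwards [hev] with p hp
      refine Eventually.of_forall fun z => ?_
      rw [norm_mul]
      gcongr
      by_cases hz : z - a p ∈ (Metric.ball (0 : E) 1)ᶜ
      · rw [Set.indicator_of_mem hz]
        exact hp _ (by simpa using hz)
      · rw [Set.indicator_of_notMem hz]; simp
    · filter_upwards [hne, hsph] with z hz hz1
      refine Tendsto.mul ?_ tendsto_const_nhds
      have h1 : Tendsto (fun p => z - a p) l (𝓝 z) := by
        simpa using tendsto_const_nhds.sub ha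
      have h2 := h1.norm
      rcases lt_or_gt_of_ne hz1 with hlt | hgt
      · rw [Set.indicator_of_notMem (by simpa using hlt)]
        refine tendsto_const_nhds.congr' ?_
        filter_upwards [h2.eventually (gt_mem_nhds hlt)] with p hp
        rw [Set.indicator_of_notMem (by simpa using hp)]
      · rw [Set.indicator_of_mem (by simpa using hgt.le)]
        refine (hlim _ z hz h1).congr' ?_
        filter_upwards [h2.eventually (lt_mem_nhds hgt)] with p hp
        rw [Set.indicator_of_mem (by simpa using le_of_lt hp)]

/-- Concentration lemma. -/
lemma kernel_conc {F : ℝ → ℝ} (hFc : Continuous F) (hF : Integrable (fun z : E => F ‖z‖) μ)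
    {P : Type*} {l : Filter P} (h : P → E → ℝ) (a : P → E) {m : ℝ}
    (ha : Tendsto a l (𝓝 0)) (hm : ∀ p, Measurable (h p)) (h0 : ∀ᶠ p in l, ∀ w, 0 ≤ h p w)
    (hintg : ∀ p, IntegrableOn (h p) (Metric.ball 0 1) μ)
    (hsmall : ∀ δ > 0, ∀ ε > 0, ∀ᶠ p in l, ∀ w : E, δ ≤ ‖w‖ → h p w ≤ ε)
    (hmass : Tendsto (fun p => ∫ w in Metric.ball 0 1, h p w ∂μ) l (𝓝 m)) :
    Tendsto (fun p => ∫ z, F ‖z‖ * h p (z - a p) ∂μ) l (𝓝 (F 0 * m)) := by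
  have hnorm : ∀ ε > 0, ∀ᶠ p in l, ∀ w : E, 1 ≤ ‖w‖ → ‖h p w‖ ≤ ε := by
    intro ε hε
    filter_upwards [hsmall 1 one_pos ε hε, h0] with p hp hp0 w hw
    rw [Real.norm_of_nonneg (hp0 w)]
    exact hp w hw
  have hsplit : ∀ᶠ p in l, ((∫ w in Metric.ball 0 1, (F ‖w + a p‖ - F 0) * h p w ∂μ) +
      F 0 * ∫ w in Metric.ball 0 1, h p w ∂μ) +
      ∫ z, (Metric.ball (0 : E) 1)ᶜ.indicator (h p) (z - a p) * F ‖z‖ ∂μ =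
      ∫ z, F ‖z‖ * h p (z - a p) ∂μ := by
    filter_upwards [hnorm 1 one_pos] with p hp1
    rw [(split_int μ hFc hF (hm p) (hintg p) zero_le_one hp1 (a p)).2]
    congr 1
    rw [← integral_const_mul, ← integral_add]
    · congr 1; ext w; ring
    · have := (split_int_aux μ hFc (hm p) (hintg p) (a := a p)).sub ((hintg p).const_mul (F 0))
      refine this.congr (Eventually.of_forall fun w => ?_)
      simp only [Pi.sub_apply]; ring
    · exact (hintg p).const_mul (F 0)
  refine Tendsto.congr' hsplit ?_
  have hfar : Tendsto (fun p => ∫ z, (Metric.ball (0 : E) 1)ᶜ.indicator (h p) (z - a p) * F ‖z‖ ∂μ)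
      l (𝓝 0) := by
    rw [Metric.tendsto_nhds]
    intro ε hε
    have hI0 : 0 ≤ ∫ z, ‖F ‖z‖‖ ∂μ := integral_nonneg fun z => norm_nonneg _
    set I := ∫ z, ‖F ‖z‖‖ ∂μ with hI
    filter_upwards [hnorm (ε / (2 * (I + 1))) (by positivity)] with p hp
    rw [dist_zero_right]
    have : ‖∫ z, (Metric.ball (0 : E) 1)ᶜ.indicator (h p) (z - a p) * F ‖z‖ ∂μ‖ ≤
        ∫ z, (ε / (2 * (I + 1))) * ‖F ‖z‖‖ ∂μ := by
      refine norm_integral_le_of_norm_le (hF.norm.const_mul _) (Eventually.of_forall fun z => ?_)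
      rw [norm_mul]
      gcongr
      by_cases hz : z - a p ∈ (Metric.ball (0 : E) 1)ᶜ
      · rw [Set.indicator_of_mem hz]
        exact hp _ (by simpa using hz)
      · rw [Set.indicator_of_notMem hz]; simp; positivity
    rw [integral_const_mul, ← hI] at this
    refine this.trans_lt ?_
    rw [div_mul_eq_mul_div, div_lt_iff₀ (by positivity)]
    nlinarith
  have hnear : Tendsto (fun p => ∫ w in Metric.ball 0 1, (F ‖w + a p‖ - F 0) * h p w ∂μ) l (𝓝 0) := by
    rw [Metric.tendsto_nhds]
    intro ε hε
    obtain ⟨M, hM0, hM⟩ := exists_bound_F (E := E) hFc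
    set V := μ.real (Metric.ball (0 : E) 1) with hV
    have hV0 : 0 ≤ V := measureReal_nonneg
    set ε1 := ε / (4 * (|m| + 1)) with hε1
    have hε1p : 0 < ε1 := by positivity
    obtain ⟨δ, hδ, hδF⟩ := Metric.continuous_iff.1 hFc 0 ε1 hε1p
    set ε2 := ε / (8 * M * (V + 1)) with hε2
    have hε2p : 0 < ε2 := by positivity
    have hanorm := ha.norm
    rw [norm_zero] at hanorm
    filter_upwards [hsmall (δ / 2) (by positivity) ε2 hε2p, h0, hanorm.eventually (gt_mem_nhds one_pos),
      hanorm.eventually (gt_mem_nhds (half_pos hδ)),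
      hmass.eventually (gt_mem_nhds (show m < |m| + 1 by linarith [le_abs_self m]))]
      with p hp hp0 hp1 hpδ hpm
    rw [dist_zero_right]
    have key : ‖∫ w in Metric.ball 0 1, (F ‖w + a p‖ - F 0) * h p w ∂μ‖ ≤
        ∫ w in Metric.ball 0 1, (ε1 * h p w + 2 * M * ε2) ∂μ := by
      refine norm_integral_le_of_norm_le (((hintg p).const_mul _).add (integrableOn_const
        measure_ball_lt_top.ne)) ?_
      refine (ae_restrict_iff' measurableSet_ball).2 (Eventually.of_forall fun w hw => ?_)
      have hw1 : ‖w‖ < 1 := by simpa using hw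
      rw [norm_mul, Real.norm_of_nonneg (hp0 w)]
      have hadd := norm_add_le w (a p)
      rcases lt_or_ge ‖w‖ (δ / 2) with hlt | hge
      · have h1 : ‖F ‖w + a p‖ - F 0‖ ≤ ε1 := by
          have := hδF ‖w + a p‖ (by
            rw [dist_zero_right, norm_norm]; linarith)
          rw [Real.dist_eq] at this
          exact this.le
        have := mul_le_mul_of_nonneg_right h1 (hp0 w)
        have : 0 ≤ 2 * M * ε2 := by positivity
        linarith
      · have h1 : ‖F ‖w + a p‖ - F 0‖ ≤ 2 * M := by
          have h2 := hM (w + a p) (by linarith)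
          have h3 := hM 0 (by simp)
          rw [norm_zero] at h3
          have := norm_sub_le (F ‖w + a p‖) (F 0)
          linarith
        have h2 : ‖F ‖w + a p‖ - F 0‖ * h p w ≤ 2 * M * ε2 :=
          mul_le_mul h1 (hp w hge) (hp0 w) (by positivity)
        have : 0 ≤ ε1 * h p w := mul_nonneg hε1p.le (hp0 w)
        linarith
    refine key.trans_lt ?_
    rw [integral_add ((hintg p).const_mul _) (integrableOn_const measure_ball_lt_top.ne),
      integral_const_mul, setIntegral_const, smul_eq_mul, ← hV]
    have k1 : ε1 * ∫ w in Metric.ball 0 1, h p w ∂μ ≤ ε1 * (|m| + 1) :=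
      mul_le_mul_of_nonneg_left hpm.le hε1p.le
    have k2 : ε1 * (|m| + 1) = ε / 4 := by rw [hε1]; field_simp
    have k3 : V * (2 * M * ε2) ≤ ε / 4 := by
      have : V * (2 * M * ε2) = ε / 4 * (V / (V + 1)) := by rw [hε2]; field_simp; ring
      rw [this]
      have : V / (V + 1) ≤ 1 := by rw [div_le_one (by positivity)]; linarith
      nlinarith
    linarith
  simpa using (hnear.add (hmass.const_mul (F 0))).add hfar

end Kernel

section Concrete

lemma integrable_norm_rpow_ball {n : ℕ} (hn : 1 ≤ n) {β : ℝ} (hβn : β < n) :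
    IntegrableOn (fun w : EuclideanSpace ℝ (Fin n) => ‖w‖ ^ (-β)) (Metric.ball 0 1) := by
  have : Nonempty (Fin n) := ⟨⟨0, hn⟩⟩
  rw [← integrable_indicator_iff measurableSet_ball]
  have e : (Metric.ball (0 : EuclideanSpace ℝ (Fin n)) 1).indicator (fun w => ‖w‖ ^ (-β)) =
      fun w => (Set.Iio (1 : ℝ)).indicator (fun r : ℝ => r ^ (-β)) ‖w‖ := by
    ext w
    by_cases hw : ‖w‖ < 1
    · rw [Set.indicator_of_mem (by simpa using hw), Set.indicator_of_mem (by simpa using hw)]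
    · rw [Set.indicator_of_notMem (by simpa using hw), Set.indicator_of_notMem (by simpa using hw)]
  rw [e, integrable_fun_norm_addHaar, finrank_euclideanSpace_fin]
  have h1 : IntegrableOn (fun r : ℝ => r ^ ((n : ℝ) - 1 - β)) (Set.Ioo 0 1) :=
    (intervalIntegral.integrableOn_Ioo_rpow_iff one_pos).2 (by linarith)
  have h2 : IntegrableOn ((Set.Iio (1 : ℝ)).indicator (fun r : ℝ => r ^ ((n : ℝ) - 1 - β))) (Set.Ioi 0) := by
    rw [IntegrableOn, integrable_indicator_iff measurableSet_Iio, IntegrableOn,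
      Measure.restrict_restrict measurableSet_Iio, Set.inter_comm, Set.Ioi_inter_Iio]
    exact h1
  refine h2.congr_fun ?_ measurableSet_Ioi
  intro r hr
  have hr : (0 : ℝ) < r := hr
  by_cases hr1 : r < 1
  · simp only [smul_eq_mul]
    rw [Set.indicator_of_mem (by simpa using hr1), Set.indicator_of_mem (by simpa using hr1),
      ← Real.rpow_natCast, ← Real.rpow_add hr, Nat.cast_sub hn, Nat.cast_one]
    congr 1
  · simp only [smul_eq_mul]
    rw [Set.indicator_of_notMem (by simpa using hr1), Set.indicator_of_notMem (by simpa using hr1),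
      mul_zero]

lemma tendsto_T {n : ℕ} (K : Set (EuclideanSpace ℝ (Fin n))) :
    Tendsto (fun p : ℝ × EuclideanSpace ℝ (Fin n) => p.1 ^ ((1 : ℝ) / 4)) (atTop ×ˢ 𝓟 K) atTop :=
  (tendsto_rpow_atTop (by norm_num)).comp tendsto_fst

lemma tendsto_a {n : ℕ} {K : Set (EuclideanSpace ℝ (Fin n))} (hK : IsCompact K) :
    Tendsto (fun p : ℝ × EuclideanSpace ℝ (Fin n) => (p.1 ^ ((1 : ℝ) / 4))⁻¹ • p.2)
      (atTop ×ˢ 𝓟 K) (𝓝 0) := by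
  obtain ⟨R, hR⟩ := hK.isBounded.exists_norm_le
  have hT := tendsto_T K
  have h1 : Tendsto (fun p : ℝ × EuclideanSpace ℝ (Fin n) => (p.1 ^ ((1 : ℝ) / 4))⁻¹ * R)
      (atTop ×ˢ 𝓟 K) (𝓝 0) := by
    simpa using (tendsto_inv_atTop_zero.comp hT).mul_const R
  refine squeeze_zero_norm' ?_ h1
  filter_upwards [hT.eventually_gt_atTop 0, tendsto_snd.eventually
    (mem_principal_self K : ∀ᶠ x in 𝓟 K, x ∈ K)] with p hp hpK
  rw [norm_smul, norm_inv, Real.norm_of_nonneg hp.le]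
  have := hR _ hpK
  gcongr

lemma shift_eq {E : Type*} [AddCommGroup E] [Module ℝ E] {T : ℝ} (hT : T ≠ 0) (x z : E) :
    x - T • z = -(T • (z - T⁻¹ • x)) := by
  rw [smul_sub, smul_inv_smul₀ hT]; abel

lemma case_one {n : ℕ} (hn : 1 ≤ n) {β : ℝ} (hβ : 0 ≤ β) (hβn : β < n)
    {F : ℝ → ℝ} (hFc : Continuous F) (hF : Integrable (fun z : EuclideanSpace ℝ (Fin n) => F ‖z‖))
    {g : EuclideanSpace ℝ (Fin n) → ℝ} (hg : memCbeta n β g)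
    {K : Set (EuclideanSpace ℝ (Fin n))} (hK : IsCompact K) :
    Tendsto (fun p : ℝ × EuclideanSpace ℝ (Fin n) => p.1 ^ (β / 4) *
      ∫ z : EuclideanSpace ℝ (Fin n), F ‖z‖ * (1 / (g (p.2 - p.1 ^ ((1 : ℝ) / 4) • z)
                    + ‖p.2 - p.1 ^ ((1 : ℝ) / 4) • z‖ ^ β))) (atTop ×ˢ 𝓟 K)
      (𝓝 (∫ z : EuclideanSpace ℝ (Fin n), F ‖z‖ * ‖z‖ ^ (-β))) := by
  have : Nonempty (Fin n) := ⟨⟨0, hn⟩⟩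
  obtain ⟨hgc, hg0, -, hgo⟩ := hg
  have hT := tendsto_T K
  let h : ℝ × EuclideanSpace ℝ (Fin n) → EuclideanSpace ℝ (Fin n) → ℝ := fun p w =>
    p.1 ^ (β / 4) * (1 / (g (-(p.1 ^ ((1 : ℝ) / 4) • w)) + ‖p.1 ^ ((1 : ℝ) / 4) • w‖ ^ β))
  have hpos : ∀ᶠ p : ℝ × EuclideanSpace ℝ (Fin n) in atTop ×ˢ 𝓟 K, 0 < p.1 :=
    tendsto_fst.eventually (eventually_gt_atTop 0)
  have hTb : ∀ t : ℝ, 0 < t → t ^ (β / 4) = (t ^ ((1 : ℝ) / 4)) ^ β := by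
    intro t ht
    rw [← Real.rpow_mul ht.le]; congr 1; ring
  have key := kernel_sub volume hFc hF hβ (integrable_norm_rpow_ball hn hβn) h _ (tendsto_a hK)
    ?_ ?_ ?_
  · refine key.congr' ?_
    filter_upwards [hpos] with p hp
    rw [← integral_const_mul]
    congr 1; ext z
    have hTp : p.1 ^ ((1 : ℝ) / 4) ≠ 0 := by positivity
    simp only [h]
    rw [shift_eq hTp p.2 z, norm_neg]
    ring
  · intro p
    simp only [h]
    have := hgc.measurable
    fun_prop
  · filter_upwards [hpos] with p hp w hw
    simp only [h]
    have hTp : 0 < p.1 ^ ((1 : ℝ) / 4) := by positivity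
    rw [hTb _ hp]
    generalize p.1 ^ ((1 : ℝ) / 4) = T at *
    have hg1 := hg0 (-(T • w))
    have hwn : 0 < ‖w‖ := norm_pos_iff.2 hw
    rw [Real.norm_of_nonneg (by positivity), norm_smul, Real.norm_of_nonneg hTp.le,
      Real.mul_rpow hTp.le hwn.le, Real.rpow_neg hwn.le]
    have h1 : 0 < T ^ β := by positivity
    have h2 : 0 < ‖w‖ ^ β := by positivity
    calc T ^ β * (1 / (g (-(T • w)) + T ^ β * ‖w‖ ^ β)) ≤ T ^ β * (1 / (T ^ β * ‖w‖ ^ β)) := by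
          gcongr; linarith
      _ = _ := by field_simp
  · intro w w0 hw0 hw
    have hw0n : 0 < ‖w0‖ := norm_pos_iff.2 hw0
    have hn1 := hw.norm
    have hy : Tendsto (fun p => -(p.1 ^ ((1 : ℝ) / 4) • w p)) (atTop ×ˢ 𝓟 K)
        (Filter.comap (fun x : EuclideanSpace ℝ (Fin n) => ‖x‖) Filter.atTop) := by
      rw [tendsto_comap_iff]
      refine (hT.atTop_mul_pos hw0n hn1).congr' ?_
      filter_upwards [hT.eventually_gt_atTop 0] with p hp
      rw [Function.comp_apply, norm_neg, norm_smul, Real.norm_of_nonneg hp.le]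
    have hq := hgo.tendsto_div_nhds_zero.comp hy
    have hb : Tendsto (fun p => ‖w p‖ ^ β) (atTop ×ˢ 𝓟 K) (𝓝 (‖w0‖ ^ β)) :=
      hn1.rpow_const (Or.inl hw0n.ne')
    have hfin : Tendsto (fun p => ((g (-(p.1 ^ ((1 : ℝ) / 4) • w p)) /
        ‖-(p.1 ^ ((1 : ℝ) / 4) • w p)‖ ^ β) * ‖w p‖ ^ β + ‖w p‖ ^ β)⁻¹) (atTop ×ˢ 𝓟 K)
        (𝓝 (‖w0‖ ^ (-β))) := by
      rw [Real.rpow_neg hw0n.le]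
      refine Tendsto.inv₀ ?_ (by positivity)
      simpa using (hq.mul hb).add hb
    refine hfin.congr' ?_
    filter_upwards [hpos, hn1.eventually (lt_mem_nhds hw0n)] with p hp hwn
    simp only [h]
    have hTp : 0 < p.1 ^ ((1 : ℝ) / 4) := by positivity
    rw [hTb _ hp]
    generalize p.1 ^ ((1 : ℝ) / 4) = T at *
    have hg1 := hg0 (-(T • w p))
    rw [norm_neg, norm_smul, Real.norm_of_nonneg hTp.le, Real.mul_rpow hTp.le hwn.le]
    have h1 : 0 < T ^ β := by positivity
    have h2 : 0 < ‖w p‖ ^ β := by positivity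
    have h3 : 0 < g (-(T • w p)) + T ^ β * ‖w p‖ ^ β := by positivity
    field_simp

lemma case_two {n : ℕ} (hn : 1 ≤ n) {β : ℝ} (hβ : 0 < β) {c : ℝ → ℝ} {m : ℝ}
    (hc0 : ∀ᶠ t in atTop, 0 ≤ c t) (hc : Tendsto (fun t : ℝ => c t * (t ^ (β / 4))⁻¹) atTop (𝓝 0))
    (hmass : Tendsto (fun t : ℝ => c t * (t ^ ((n : ℝ) / 4))⁻¹ *
      ∫ y in Metric.ball (0 : EuclideanSpace ℝ (Fin n)) (t ^ ((1 : ℝ) / 4)), 1 / (1 + ‖y‖ ^ β)) atTop (𝓝 m))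
    {F : ℝ → ℝ} (hFc : Continuous F) (hF : Integrable (fun z : EuclideanSpace ℝ (Fin n) => F ‖z‖))
    {K : Set (EuclideanSpace ℝ (Fin n))} (hK : IsCompact K) :
    Tendsto (fun p : ℝ × EuclideanSpace ℝ (Fin n) => c p.1 *
      ∫ z : EuclideanSpace ℝ (Fin n), F ‖z‖ * (1 / (1 + ‖p.2 - p.1 ^ ((1 : ℝ) / 4) • z‖ ^ β)))
      (atTop ×ˢ 𝓟 K) (𝓝 (F 0 * m)) := by
  have : Nonempty (Fin n) := ⟨⟨0, hn⟩⟩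
  have hT := tendsto_T K
  let h : ℝ × EuclideanSpace ℝ (Fin n) → EuclideanSpace ℝ (Fin n) → ℝ := fun p w =>
    c p.1 * (1 / (1 + ‖p.1 ^ ((1 : ℝ) / 4) • w‖ ^ β))
  have hpos : ∀ᶠ p : ℝ × EuclideanSpace ℝ (Fin n) in atTop ×ˢ 𝓟 K, 0 < p.1 :=
    tendsto_fst.eventually (eventually_gt_atTop 0)
  have hc0' : ∀ᶠ p : ℝ × EuclideanSpace ℝ (Fin n) in atTop ×ˢ 𝓟 K, 0 ≤ c p.1 :=
    tendsto_fst.eventually hc0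
  have hTb : ∀ t γ : ℝ, 0 < t → t ^ (γ / 4) = (t ^ ((1 : ℝ) / 4)) ^ γ := by
    intro t γ ht
    rw [← Real.rpow_mul ht.le]; congr 1; ring
  have hcont : ∀ p, Continuous (h p) := by
    intro p
    simp only [h]
    refine continuous_const.mul (continuous_const.div ?_ fun w => ?_)
    · exact continuous_const.add (Continuous.rpow_const (by fun_prop) fun w => Or.inr hβ.le)
    · positivity
  have key := kernel_conc volume hFc hF h _ (m := m) (tendsto_a hK) (fun p => (hcont p).measurable)
    ?_ ?_ ?_ ?_
  · refine key.congr' ?_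
    filter_upwards [hpos] with p hp
    rw [← integral_const_mul]
    congr 1; ext z
    have hTp : p.1 ^ ((1 : ℝ) / 4) ≠ 0 := by positivity
    simp only [h]
    rw [shift_eq hTp p.2 z, norm_neg]
    ring
  · filter_upwards [hc0'] with p hp w
    simp only [h]
    positivity
  · intro p
    exact ((hcont p).continuousOn.integrableOn_compact (isCompact_closedBall 0 1)).mono_set
      Metric.ball_subset_closedBall
  · intro δ hδ ε hε
    have h1 : Tendsto (fun p : ℝ × EuclideanSpace ℝ (Fin n) => c p.1 * (p.1 ^ (β / 4))⁻¹)
        (atTop ×ˢ 𝓟 K) (𝓝 0) := hc.comp tendsto_fst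
    have hd : 0 < δ ^ β := by positivity
    filter_upwards [hpos, hc0', h1.eventually (gt_mem_nhds (mul_pos hε hd))] with p hp hcp hlt w hw
    simp only [h]
    rw [hTb _ _ hp] at hlt
    have hTp : 0 < p.1 ^ ((1 : ℝ) / 4) := by positivity
    generalize p.1 ^ ((1 : ℝ) / 4) = T at *
    rw [norm_smul, Real.norm_of_nonneg hTp.le, Real.mul_rpow hTp.le (norm_nonneg w)]
    have h1 : 0 < T ^ β := by positivity
    have h2 : δ ^ β ≤ ‖w‖ ^ β := Real.rpow_le_rpow hδ.le hw hβ.le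
    calc c p.1 * (1 / (1 + T ^ β * ‖w‖ ^ β)) ≤ c p.1 * (1 / (T ^ β * δ ^ β)) := by
          gcongr
          nlinarith [mul_le_mul_of_nonneg_left h2 h1.le]
      _ = (c p.1 * (T ^ β)⁻¹) * (δ ^ β)⁻¹ := by field_simp
      _ ≤ (ε * δ ^ β) * (δ ^ β)⁻¹ := by gcongr
      _ = ε := by field_simp
  · have h1 := hmass.comp (tendsto_fst (f := atTop) (g := 𝓟 K))
    refine h1.congr' ?_
    filter_upwards [hpos] with p hp
    simp only [h, Function.comp]
    have hTp : 0 < p.1 ^ ((1 : ℝ) / 4) := by positivity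
    rw [integral_const_mul, Measure.setIntegral_comp_smul_of_pos volume
      (fun y : EuclideanSpace ℝ (Fin n) => 1 / (1 + ‖y‖ ^ β)) _ hTp, finrank_euclideanSpace_fin,
      smul_unitBall_of_pos hTp, hTb _ _ hp, Real.rpow_natCast, smul_eq_mul]
    ring

lemma mass_gt {n : ℕ} (hn : 1 ≤ n) {β : ℝ} (hβ : (n : ℝ) < β) :
    0 < ∫ y : EuclideanSpace ℝ (Fin n), 1 / (1 + ‖y‖ ^ β) ∧
    Tendsto (fun t : ℝ => ∫ y in Metric.ball (0 : EuclideanSpace ℝ (Fin n)) (t ^ ((1 : ℝ) / 4)),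
      1 / (1 + ‖y‖ ^ β)) atTop (𝓝 (∫ y : EuclideanSpace ℝ (Fin n), 1 / (1 + ‖y‖ ^ β))) := by
  have hβ0 : 0 < β := lt_of_le_of_lt (Nat.cast_nonneg n) hβ
  have hcont : Continuous (fun y : EuclideanSpace ℝ (Fin n) => 1 / (1 + ‖y‖ ^ β)) := by
    refine continuous_const.div ?_ fun w => ?_
    · exact continuous_const.add (Continuous.rpow_const (by fun_prop) fun w => Or.inr hβ0.le)
    · positivity
  have hintg : Integrable (fun y : EuclideanSpace ℝ (Fin n) => 1 / (1 + ‖y‖ ^ β)) := by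
    have h1 := (integrable_one_add_norm (E := EuclideanSpace ℝ (Fin n)) (μ := volume) (r := β)
      (by rw [finrank_euclideanSpace_fin]; exact hβ)).const_mul ((2 : ℝ) ^ β)
    refine h1.mono' hcont.aestronglyMeasurable (Eventually.of_forall fun y => ?_)
    have hy := norm_nonneg y
    rw [Real.norm_of_nonneg (by positivity), Real.rpow_neg (by positivity), ← div_eq_mul_inv,
      div_le_div_iff₀ (by positivity) (by positivity), one_mul]
    rcases le_total ‖y‖ 1 with h | h
    · calc (1 + ‖y‖) ^ β ≤ 2 ^ β := Real.rpow_le_rpow (by positivity) (by linarith) hβ0.le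
        _ ≤ 2 ^ β * (1 + ‖y‖ ^ β) := by
          have : 0 ≤ (2 : ℝ) ^ β * ‖y‖ ^ β := by positivity
          linarith
    · calc (1 + ‖y‖) ^ β ≤ (2 * ‖y‖) ^ β := Real.rpow_le_rpow (by positivity) (by linarith) hβ0.le
        _ = 2 ^ β * ‖y‖ ^ β := Real.mul_rpow (by norm_num) hy
        _ ≤ 2 ^ β * (1 + ‖y‖ ^ β) := by gcongr; linarith
  constructor
  · rw [integral_pos_iff_support_of_nonneg (fun y => by positivity) hintg]
    have : Function.support (fun y : EuclideanSpace ℝ (Fin n) => 1 / (1 + ‖y‖ ^ β)) = Set.univ := by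
      ext y
      simp only [Function.mem_support, Set.mem_univ, iff_true]
      positivity
    rw [this]
    exact isOpen_univ.measure_pos _ Set.univ_nonempty
  · exact (aecover_ball (tendsto_rpow_atTop (by norm_num))).integral_tendsto_of_countably_generated hintg

lemma mass_eq {n : ℕ} (hn : 1 ≤ n) :
    Tendsto (fun t : ℝ => (Real.log t)⁻¹ *
      ∫ y in Metric.ball (0 : EuclideanSpace ℝ (Fin n)) (t ^ ((1 : ℝ) / 4)), 1 / (1 + ‖y‖ ^ (n : ℝ)))
      atTop (𝓝 ((volume : Measure (EuclideanSpace ℝ (Fin n))).real (Metric.ball 0 1) * ((n : ℝ) / 4))) := by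
  have : Nonempty (Fin n) := ⟨⟨0, hn⟩⟩
  have hn' : (0 : ℝ) < n := by exact_mod_cast hn
  set V := (volume : Measure (EuclideanSpace ℝ (Fin n))).real (Metric.ball 0 1) with hV
  have hI : ∀ T : ℝ, 0 < T → ∫ y in Metric.ball (0 : EuclideanSpace ℝ (Fin n)) T,
      1 / (1 + ‖y‖ ^ (n : ℝ)) = V * Real.log (1 + T ^ n) := by
    intro T hT
    rw [← integral_indicator measurableSet_ball]
    have e : (Metric.ball (0 : EuclideanSpace ℝ (Fin n)) T).indicator
        (fun y => 1 / (1 + ‖y‖ ^ (n : ℝ))) =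
        fun w => (Set.Iio T).indicator (fun r : ℝ => 1 / (1 + r ^ n)) ‖w‖ := by
      ext w
      by_cases hw : ‖w‖ < T
      · rw [Set.indicator_of_mem (by simpa using hw), Set.indicator_of_mem (by simpa using hw),
          Real.rpow_natCast]
      · rw [Set.indicator_of_notMem (by simpa using hw), Set.indicator_of_notMem (by simpa using hw)]
    rw [e, integral_fun_norm_addHaar, finrank_euclideanSpace_fin, ← hV]
    have e2 : ∫ y in Set.Ioi (0 : ℝ), y ^ (n - 1) • (Set.Iio T).indicator (fun r : ℝ => 1 / (1 + r ^ n)) y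
        = ∫ y in (0 : ℝ)..T, y ^ (n - 1) / (1 + y ^ n) := by
      have e3 : ∀ y : ℝ, y ^ (n - 1) • (Set.Iio T).indicator (fun r : ℝ => 1 / (1 + r ^ n)) y =
          (Set.Iio T).indicator (fun y => y ^ (n - 1) / (1 + y ^ n)) y := by
        intro y
        by_cases hy : y < T
        · rw [Set.indicator_of_mem (by simpa using hy), Set.indicator_of_mem (by simpa using hy),
            smul_eq_mul]; ring
        · rw [Set.indicator_of_notMem (by simpa using hy), Set.indicator_of_notMem (by simpa using hy),
            smul_zero]
      simp only [e3]
      rw [integral_indicator measurableSet_Iio, Measure.restrict_restrict measurableSet_Iio,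
        Set.inter_comm, Set.Ioi_inter_Iio, intervalIntegral.integral_of_le hT.le,
        integral_Ioc_eq_integral_Ioo]
    have hpos : ∀ y ∈ Set.uIcc 0 T, 0 < 1 + y ^ n := by
      intro y hy
      rw [Set.uIcc_of_le hT.le] at hy
      have := pow_nonneg hy.1 n
      linarith
    have e4 : ∫ y in (0 : ℝ)..T, y ^ (n - 1) / (1 + y ^ n) = Real.log (1 + T ^ n) / n := by
      rw [intervalIntegral.integral_eq_sub_of_hasDerivAt (f := fun y => Real.log (1 + y ^ n) / n)]
      · simp [zero_pow (by omega : n ≠ 0)]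
      · intro y hy
        have h1 : HasDerivAt (fun y : ℝ => 1 + y ^ n) (n * y ^ (n - 1)) y :=
          (hasDerivAt_pow n y).const_add 1
        have h2 := (h1.log (hpos y hy).ne').div_const (n : ℝ)
        refine h2.congr_deriv ?_
        have h3 := (hpos y hy).ne'
        have h4 := hn'.ne'
        field_simp
      · refine ContinuousOn.intervalIntegrable ?_
        exact ContinuousOn.div (by fun_prop) (by fun_prop) fun y hy => (hpos y hy).ne'
    rw [e2, e4, nsmul_eq_mul, smul_eq_mul]
    field_simp
  have hlim : Tendsto (fun t : ℝ => V * ((n : ℝ) / 4 + Real.log (1 + t ^ (-((n : ℝ) / 4))) * (Real.log t)⁻¹))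
      atTop (𝓝 (V * ((n : ℝ) / 4 + 0 * 0))) := by
    refine tendsto_const_nhds.mul (tendsto_const_nhds.add (Tendsto.mul ?_ ?_))
    · have h1 : Tendsto (fun t : ℝ => 1 + t ^ (-((n : ℝ) / 4))) atTop (𝓝 (1 + 0)) :=
        tendsto_const_nhds.add (tendsto_rpow_neg_atTop (by positivity))
      have h2 := h1.log (by norm_num)
      simpa using h2
    · exact tendsto_inv_atTop_zero.comp Real.tendsto_log_atTop
  rw [mul_zero, add_zero] at hlim
  refine hlim.congr' ?_
  filter_upwards [eventually_gt_atTop 1] with t ht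
  have ht0 : 0 < t := by linarith
  have hl : 0 < Real.log t := Real.log_pos ht
  rw [hI _ (by positivity)]
  have e5 : (t ^ ((1 : ℝ) / 4)) ^ n = t ^ ((n : ℝ) / 4) := by
    rw [← Real.rpow_natCast, ← Real.rpow_mul ht0.le]; congr 1; ring
  have e6 : 1 + t ^ ((n : ℝ) / 4) = t ^ ((n : ℝ) / 4) * (1 + t ^ (-((n : ℝ) / 4))) := by
    rw [mul_add, ← Real.rpow_add ht0]; simp [add_comm]
  rw [e5, e6, Real.log_mul (by positivity) (by positivity), Real.log_rpow ht0]
  field_simp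

end Concrete

/-- asymptotic behavior of the biharmonic heat flow for data
`u_0(x) = 1/(g(x)+|x|^β)`: locally uniform decay of exact rate `t^{-β/4}` when `β < n`
(with a limit constant independent of `g` and of the compact set), and rate `t^{-n/4} log t`
(resp. `t^{-n/4}`) when `β = n` (resp. `β > n`) for `g ≡ 1`. -/
theorem biharmonic_decay_rates (n : ℕ) (hn : 1 ≤ n) (β : ℝ) (hβ : 0 ≤ β)
    (α : ℝ) (hα : 0 < α)
    (hαdef : α⁻¹ = ∫ x : EuclideanSpace ℝ (Fin n), fmn 2 n ‖x‖) :
    (β < n →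
      ∃ C > (0 : ℝ), ∀ g : EuclideanSpace ℝ (Fin n) → ℝ, memCbeta n β g →
        ∀ K : Set (EuclideanSpace ℝ (Fin n)), IsCompact K →
          TendstoUniformlyOn
            (fun (t : ℝ) (x : EuclideanSpace ℝ (Fin n)) =>
              t ^ (β / 4) * (α * ∫ z : EuclideanSpace ℝ (Fin n),
                fmn 2 n ‖z‖ *
                  (1 / (g (x - t ^ ((1 : ℝ) / 4) • z)
                    + ‖x - t ^ ((1 : ℝ) / 4) • z‖ ^ β))))
            (fun _ => C) atTop K) ∧
    ((n : ℝ) ≤ β →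
      ∃ D > (0 : ℝ), ∀ K : Set (EuclideanSpace ℝ (Fin n)), IsCompact K →
        (β = n →
          TendstoUniformlyOn
            (fun (t : ℝ) (x : EuclideanSpace ℝ (Fin n)) =>
              t ^ ((n : ℝ) / 4) * (Real.log t)⁻¹ * (α * ∫ z : EuclideanSpace ℝ (Fin n),
                fmn 2 n ‖z‖ * (1 / (1 + ‖x - t ^ ((1 : ℝ) / 4) • z‖ ^ β))))
            (fun _ => D) atTop K) ∧
        ((n : ℝ) < β →
          TendstoUniformlyOn
            (fun (t : ℝ) (x : EuclideanSpace ℝ (Fin n)) =>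
              t ^ ((n : ℝ) / 4) * (α * ∫ z : EuclideanSpace ℝ (Fin n),
                fmn 2 n ‖z‖ * (1 / (1 + ‖x - t ^ ((1 : ℝ) / 4) • z‖ ^ β))))
            (fun _ => D) atTop K)) := by
  have : Nonempty (Fin n) := ⟨⟨0, hn⟩⟩
  have hn0 : (0 : ℝ) < n := by exact_mod_cast hn
  have hFc := bF_continuous hn
  have hae : ∀ᵐ z : EuclideanSpace ℝ (Fin n), fmn 2 n ‖z‖ = bF n ‖z‖ := by
    have hne : ∀ᵐ z : EuclideanSpace ℝ (Fin n), z ≠ 0 := by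
      rw [ae_iff]; simp
    exact hne.mono fun z hz => fmn_eq_bF hn (norm_pos_iff.2 hz)
  have hrep : ∀ v : EuclideanSpace ℝ (Fin n) → ℝ,
      ∫ z, bF n ‖z‖ * v z = ∫ z, fmn 2 n ‖z‖ * v z := fun v =>
    integral_congr_ae (hae.mono fun z hz => by simp only [hz])
  have hαF : α⁻¹ = ∫ x : EuclideanSpace ℝ (Fin n), bF n ‖x‖ := by
    rw [hαdef]; exact integral_congr_ae hae
  have hF : Integrable (fun z : EuclideanSpace ℝ (Fin n) => bF n ‖z‖) := by
    by_contra hcon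
    rw [integral_undef hcon] at hαF
    exact (inv_pos.2 hα).ne' hαF
  constructor
  · intro hβn
    refine ⟨α * ∫ z : EuclideanSpace ℝ (Fin n), bF n ‖z‖ * ‖z‖ ^ (-β), mul_pos hα ?_, ?_⟩
    · rcases hβ.eq_or_lt with h0 | hβ0
      · subst h0
        simp only [neg_zero, Real.rpow_zero, mul_one]
        rw [← hαF]; exact inv_pos.2 hα
      · have hi := (split_int volume hFc hF (h := fun w : EuclideanSpace ℝ (Fin n) => ‖w‖ ^ (-β))
          (by fun_prop) (integrable_norm_rpow_ball hn hβn) zero_le_one (fun w hw => by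
            rw [Real.norm_of_nonneg (by positivity)]
            exact Real.rpow_le_one_of_one_le_of_nonpos hw (by linarith)) 0).1
        simp only [sub_zero] at hi
        rw [integrable_fun_norm_addHaar volume (f := fun r => bF n r * r ^ (-β)),
          finrank_euclideanSpace_fin] at hi
        rw [integral_fun_norm_addHaar volume (fun r => bF n r * r ^ (-β)),
          finrank_euclideanSpace_fin, nsmul_eq_mul]
        simp only [smul_eq_mul] at hi ⊢
        have hV : 0 < (volume : Measure (EuclideanSpace ℝ (Fin n))).real (Metric.ball 0 1) :=
          ENNReal.toReal_pos (Metric.measure_ball_pos _ _ one_pos).ne' measure_ball_lt_top.ne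
        exact mul_pos hn0 (mul_pos hV (bF_riesz_pos hn hβ0 hi))
    · intro g hg K hK
      rw [← tendsto_prod_principal_iff]
      refine ((case_one hn hβ hβn hFc hF hg hK).const_mul α).congr fun p => ?_
      rw [hrep]
      simp only [Function.HasUncurry.uncurry, id]
      ring
  · intro hnβ
    have hβ0 : 0 < β := hn0.trans_le hnβ
    rcases hnβ.eq_or_lt with heq | hlt
    · subst heq
      have hV : 0 < (volume : Measure (EuclideanSpace ℝ (Fin n))).real (Metric.ball 0 1) :=
        ENNReal.toReal_pos (Metric.measure_ball_pos _ _ one_pos).ne' measure_ball_lt_top.ne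
      refine ⟨α * (bF n 0 * ((volume : Measure (EuclideanSpace ℝ (Fin n))).real (Metric.ball 0 1) *
        ((n : ℝ) / 4))), ?_, fun K hK => ⟨fun _ => ?_, fun h => absurd h (lt_irrefl _)⟩⟩
      · have := bF_zero_pos hn
        positivity
      · rw [← tendsto_prod_principal_iff]
        refine ((case_two hn hβ0 (c := fun t => t ^ ((n : ℝ) / 4) * (Real.log t)⁻¹) ?_ ?_ ?_
          hFc hF hK).const_mul α).congr fun p => ?_
        · filter_upwards [eventually_gt_atTop 1] with t ht
          have := Real.log_pos ht
          have : 0 < t := by linarith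
          positivity
        · refine (tendsto_inv_atTop_zero.comp Real.tendsto_log_atTop).congr' ?_
          filter_upwards [eventually_gt_atTop 0] with t ht
          have : t ^ ((n : ℝ) / 4) ≠ 0 := by positivity
          simp only [Function.comp]
          field_simp
        · refine (mass_eq hn).congr' ?_
          filter_upwards [eventually_gt_atTop 0] with t ht
          have : t ^ ((n : ℝ) / 4) ≠ 0 := by positivity
          field_simp
        · rw [hrep]
          simp only [Function.HasUncurry.uncurry, id]
          ring
    · obtain ⟨hmp, hmt⟩ := mass_gt hn hlt
      refine ⟨α * (bF n 0 * ∫ y : EuclideanSpace ℝ (Fin n), 1 / (1 + ‖y‖ ^ β)), ?_,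
        fun K hK => ⟨fun h => absurd h hlt.ne', fun _ => ?_⟩⟩
      · exact mul_pos hα (mul_pos (bF_zero_pos hn) hmp)
      · rw [← tendsto_prod_principal_iff]
        refine ((case_two hn hβ0 (c := fun t => t ^ ((n : ℝ) / 4)) ?_ ?_ ?_
          hFc hF hK).const_mul α).congr fun p => ?_
        · filter_upwards [eventually_gt_atTop 0] with t ht
          positivity
        · refine (tendsto_rpow_neg_atTop (y := (β - n) / 4) (by linarith)).congr' ?_
          filter_upwards [eventually_gt_atTop 0] with t ht
          rw [← Real.rpow_neg ht.le, ← Real.rpow_add ht]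
          congr 1; ring
        · refine hmt.congr' ?_
          filter_upwards [eventually_gt_atTop 0] with t ht
          have : t ^ ((n : ℝ) / 4) ≠ 0 := by positivity
          rw [mul_inv_cancel₀ this, one_mul]
        · rw [hrep]
          simp only [Function.HasUncurry.uncurry, id]
          ring
end

section
/- Let n = 1. There exists β_0 > 0 such that for every β ∈ (0, β_0), the function u(x,t) = α_1 ∫_ℝ f_1(|z|) |x − t^{1/4} z|^{−β} dz, which is the solution of the one-dimensional biharmonic heat equation u_t + u_{xxxx} = 0 with initial datum u_0(x) = |x|^{−β}, satisfies u(x,t) > 0 for all (x,t) ∈ ℝ × (0,∞). -/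
open MeasureTheory Real Filter Topology

lemma bessel_half (y : ℝ) (hy : 0 < y) :
    y ^ ((1 : ℝ) / 2) * besselJ (((1 : ℝ) - 2) / 2) y = √2 / √π * Real.cos y := by
  have h := (Real.hasSum_cos y).mul_left (√2 / √π)
  have hc : y ^ ((1 : ℝ) / 2) = √y := (Real.sqrt_eq_rpow y).symm
  rw [besselJ, ← tsum_mul_left, ← h.tsum_eq]
  congr 1
  ext k
  have e1 : (k : ℝ) + ((1 : ℝ) - 2) / 2 + 1 = k + 1 / 2 := by ring
  have e2 : (y / 2) ^ ((2 * k : ℝ) + ((1 : ℝ) - 2) / 2) = (y / 2) ^ (2 * k) * (√2 / √y) := by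
    rw [Real.rpow_add (by positivity)]
    congr 1
    · rw [← Real.rpow_natCast]; push_cast; rfl
    · rw [show ((1 : ℝ) - 2) / 2 = -(1 / 2) by norm_num, Real.rpow_neg (by positivity),
        ← Real.sqrt_eq_rpow, Real.sqrt_div hy.le, inv_div]
  have e3 : ((2 * k).factorial : ℝ) = (2 * k - 1).doubleFactorial * (2 ^ k * k.factorial) := by
    rcases k with _ | k
    · simp
    · have h1 := Nat.factorial_eq_mul_doubleFactorial (2 * k + 1)
      have h2 := Nat.doubleFactorial_two_mul (k + 1)
      rw [show 2 * (k + 1) = 2 * k + 1 + 1 by ring] at *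
      rw [h2] at h1
      rw [h1]
      push_cast
      ring
  rw [e1, e2, Real.Gamma_nat_add_half, hc, e3]
  have hd : ((2 * k - 1).doubleFactorial : ℝ) ≠ 0 := by
    exact_mod_cast (Nat.doubleFactorial_pos _).ne'
  have hk : (k.factorial : ℝ) ≠ 0 := by exact_mod_cast Nat.factorial_ne_zero k
  have hp : √π ≠ 0 := (Real.sqrt_pos.2 Real.pi_pos).ne'
  have hsy : √y ≠ 0 := (Real.sqrt_pos.2 hy).ne'
  rw [div_pow, pow_mul 2 2 k, show (2 : ℝ) ^ 2 = 2 * 2 by norm_num, mul_pow]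
  field_simp

lemma fmn_eq_s18 (η : ℝ) (hη : 0 < η) :
    fmn 2 1 η = √2 / √π * ∫ s in Set.Ioi (0 : ℝ), Real.exp (-(s ^ 4)) * Real.cos (η * s) := by
  unfold fmn
  simp only [Nat.cast_one, sub_self, Real.rpow_zero, one_mul]
  rw [← integral_const_mul]
  refine setIntegral_congr_fun measurableSet_Ioi fun s hs => ?_
  have hs' : 0 < s := hs
  have := bessel_half (η * s) (by positivity)
  simp only [mul_assoc]
  rw [this]
  norm_num
  ring

/-- polynomial times `exp (-s^4)` -/
noncomputable def pq (P : Polynomial ℝ) (s : ℝ) : ℂ := ((P.eval s * Real.exp (-(s ^ 4)) : ℝ) : ℂ)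

lemma pq_integrable (P : Polynomial ℝ) : Integrable (pq P) := by
  suffices h : Integrable (fun s : ℝ => P.eval s * Real.exp (-(s ^ 4))) from h.ofReal
  induction P using Polynomial.induction_on' with
  | add p q hp hq => 
    refine (hp.add hq).congr (Eventually.of_forall fun s => ?_)
    simp [add_mul]
  | monomial n a =>
    have h := integrable_rpow_mul_exp_neg_mul_sq (b := 1) one_pos (s := (n : ℝ))
      (lt_of_lt_of_le (by norm_num) (Nat.cast_nonneg n))
    have h2 := (h.norm.const_mul (|a| * Real.exp 1))
    refine h2.mono' (by fun_prop) (Eventually.of_forall fun s => ?_)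
    simp only [Polynomial.eval_monomial, norm_mul, Real.norm_eq_abs, Real.abs_exp, Real.rpow_natCast]
    have : Real.exp (-s ^ 4) ≤ Real.exp 1 * Real.exp (-1 * s ^ 2) := by
      rw [← Real.exp_add]
      apply Real.exp_le_exp.2
      nlinarith [sq_nonneg (s ^ 2 - 1)]
    calc |a| * |s ^ n| * Real.exp (-s ^ 4)
        ≤ |a| * |s ^ n| * (Real.exp 1 * Real.exp (-1 * s ^ 2)) := by gcongr
      _ = _ := by ring

lemma pq_hasDerivAt (P : Polynomial ℝ) (s : ℝ) :
    HasDerivAt (pq P) (pq (P.derivative - 4 * Polynomial.X ^ 3 * P) s) s := by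
  suffices h : HasDerivAt (fun s : ℝ => P.eval s * Real.exp (-(s ^ 4)))
      ((P.derivative - 4 * Polynomial.X ^ 3 * P).eval s * Real.exp (-(s ^ 4))) s from h.ofReal_comp
  have h1 := P.hasDerivAt s
  have h2 : HasDerivAt (fun s : ℝ => Real.exp (-(s ^ 4))) (Real.exp (-(s ^ 4)) * -(4 * s ^ 3)) s := by
    have := ((hasDerivAt_pow 4 s).neg).exp
    simpa using this
  refine (h1.mul h2).congr_deriv ?_
  simp only [Polynomial.eval_sub, Polynomial.eval_mul, Polynomial.eval_pow, Polynomial.eval_X,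
    Polynomial.eval_ofNat]
  ring

lemma pq_fourier (P : Polynomial ℝ) (x : ℝ) :
    FourierTransform.fourier (pq (P.derivative - 4 * Polynomial.X ^ 3 * P)) x
      = (2 * π * Complex.I * x) * FourierTransform.fourier (pq P) x := by
  have hd : deriv (pq P) = pq (P.derivative - 4 * Polynomial.X ^ 3 * P) :=
    funext fun s => (pq_hasDerivAt P s).deriv
  have := Real.fourier_deriv (pq_integrable P) (fun s => (pq_hasDerivAt P s).differentiableAt)
    (by rw [hd]; exact pq_integrable _)
  rw [hd] at this
  rw [this]
  rfl

lemma pq_fourier_bdd (P : Polynomial ℝ) : ∃ C : ℝ, ∀ x : ℝ,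
    ‖FourierTransform.fourier (pq P) x‖ ≤ C :=
  ⟨∫ v, ‖pq P v‖, fun x => VectorFourier.norm_fourierIntegral_le_integral_norm _ _ _ _ _⟩

lemma pq_fourier_decay : ∃ C : ℝ, ∀ x : ℝ,
    (1 + (2 * π * |x|) ^ 3) * ‖FourierTransform.fourier (pq 1) x‖ ≤ C := by
  obtain ⟨C0, h0⟩ := pq_fourier_bdd 1
  let D : Polynomial ℝ → Polynomial ℝ := fun P => P.derivative - 4 * Polynomial.X ^ 3 * P
  obtain ⟨C1, h1⟩ := pq_fourier_bdd (D (D (D 1)))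
  refine ⟨C0 + C1, fun x => ?_⟩
  have h2 := h1 x
  simp only [D] at h2
  rw [pq_fourier, pq_fourier, pq_fourier] at h2
  simp only [norm_mul, Complex.norm_real, Complex.norm_I, Complex.norm_ofNat, Real.norm_eq_abs,
    abs_of_pos Real.pi_pos, mul_one] at h2
  have := h0 x
  nlinarith

lemma fourier_re (η : ℝ) :
    2 * ∫ s in Set.Ioi (0 : ℝ), Real.exp (-(s ^ 4)) * Real.cos (η * s)
      = (FourierTransform.fourier (pq 1) (η / (2 * π))).re := by
  rw [← integral_comp_abs (f := fun s => Real.exp (-(s ^ 4)) * Real.cos (η * s)),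
    Real.fourier_real_eq_integral_exp_smul]
  have hint : Integrable (fun v : ℝ =>
      Complex.exp (↑(-2 * π * v * (η / (2 * π))) * Complex.I) • pq 1 v) := by
    refine (pq_integrable 1).norm.mono' ?_ (Eventually.of_forall fun s => ?_)
    · have hc : Continuous (fun v : ℝ => Complex.exp (↑(-2 * π * v * (η / (2 * π))) * Complex.I)) := by
        fun_prop
      exact hc.aestronglyMeasurable.smul (pq_integrable 1).1
    · rw [norm_smul, Complex.norm_exp_ofReal_mul_I, one_mul]
  have h := integral_re (𝕜 := ℂ) hint
  simp only [RCLike.re_eq_complex_re] at h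
  rw [← h]
  congr 1
  ext s
  have e : -2 * π * s * (η / (2 * π)) = -(η * s) := by
    have := Real.pi_pos.ne'
    field_simp
  have e2 : Real.cos (η * |s|) = Real.cos (η * s) := by
    rcases abs_choice s with h | h <;> simp [h]
  have e3 : |s| ^ 4 = s ^ 4 := by
    rw [show 4 = 2 * 2 by norm_num, pow_mul, pow_mul, sq_abs]
  rw [e, e2, e3, smul_eq_mul, pq, Complex.re_mul_ofReal, Complex.exp_ofReal_mul_I_re]
  simp
  ring

lemma fmn_decay : ∃ C : ℝ, 0 < C ∧ ∀ z : ℝ, z ≠ 0 →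
    abs (fmn 2 1 |z|) * (1 + |z|) ≤ C * (1 + z ^ 2)⁻¹ := by
  obtain ⟨C, hC⟩ := pq_fourier_decay
  have hC0 : 0 ≤ C := le_trans (by positivity) (hC 0)
  set c := √2 / √π with hc
  have hcpos : 0 < c := by have := Real.pi_pos; positivity
  refine ⟨4 * c * C + 1, by positivity, fun z hz => ?_⟩
  have hz' : 0 < |z| := abs_pos.2 hz
  set a := |z| with ha
  have h1 := fourier_re a
  have h2 := hC (a / (2 * π))
  have e : 2 * π * |a / (2 * π)| = a := by
    have := Real.pi_pos
    rw [abs_of_pos (by positivity)]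
    field_simp
  rw [e] at h2
  have h3 := Complex.abs_re_le_norm (FourierTransform.fourier (pq 1) (a / (2 * π)))
  rw [← h1] at h3
  rw [fmn_eq_s18 a hz']
  set J := ∫ s in Set.Ioi (0 : ℝ), Real.exp (-(s ^ 4)) * Real.cos (a * s)
  rw [abs_mul] at h3
  rw [abs_mul, abs_of_pos hcpos, le_mul_inv_iff₀ (by positivity), ← sq_abs z, ← ha]
  have h4 : (1 + a ^ 3) * |J| ≤ C := by
    refine le_trans ?_ h2
    gcongr
    have := abs_nonneg J
    norm_num at h3
    linarith
  have h5 : (1 + a) * (1 + a ^ 2) ≤ 4 * (1 + a ^ 3) := by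
    nlinarith [mul_nonneg hz'.le (sq_nonneg (a - 1)), sq_nonneg (a - 1)]
  calc c * |J| * (1 + a) * (1 + a ^ 2) = c * |J| * ((1 + a) * (1 + a ^ 2)) := by ring
    _ ≤ c * |J| * (4 * (1 + a ^ 3)) := by gcongr
    _ = 4 * c * ((1 + a ^ 3) * |J|) := by ring
    _ ≤ 4 * c * C := by gcongr
    _ ≤ _ := by linarith

lemma rpow_sub_one_bound (w β : ℝ) (hw : 0 < w) (hβ : 0 < β) (hβ' : β ≤ 1 / 4) :
    |w ^ (-β) - 1| ≤ β * (w + 4 * w ^ (-(1 / 2) : ℝ)) := by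
  have hw2 : 0 < w ^ (-(1 / 2) : ℝ) := Real.rpow_pos_of_pos hw _
  rcases le_total 1 w with h | h
  · have h1 : w ^ (-β) ≤ 1 := Real.rpow_le_one_of_one_le_of_nonpos h (by linarith)
    rw [abs_of_nonpos (by linarith)]
    have h2 : w ^ (-β) = Real.exp (-(β * Real.log w)) := by
      rw [Real.rpow_def_of_pos hw]; congr 1; ring
    have h3 := Real.add_one_le_exp (-(β * Real.log w))
    have h4 := Real.log_le_sub_one_of_pos hw
    rw [h2]
    nlinarith
  · have h1 : 1 ≤ w ^ (-β) := Real.one_le_rpow_of_pos_of_le_one_of_nonpos hw h (by linarith)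
    rw [abs_of_nonneg (by linarith)]
    have h2 : w ^ β = Real.exp (β * Real.log w) := by
      rw [Real.rpow_def_of_pos hw]; congr 1; ring
    have h3 := Real.add_one_le_exp (β * Real.log w)
    rw [← h2] at h3
    have h4 := Real.log_le_rpow_div (x := w⁻¹) (by positivity) (ε := 1 / 4) (by norm_num)
    rw [Real.log_inv, Real.inv_rpow hw.le, ← Real.rpow_neg hw.le] at h4
    have h5 : w ^ (-β) ≤ w ^ (-(1 / 4) : ℝ) := Real.rpow_le_rpow_of_exponent_ge hw h (by linarith)
    have h6 : w ^ (-β) * w ^ β = 1 := by rw [← Real.rpow_add hw]; simp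
    have h7 : w ^ (-(1 / 4) : ℝ) * w ^ (-(1 / 4) : ℝ) = w ^ (-(1 / 2) : ℝ) := by
      rw [← Real.rpow_add hw]; norm_num
    have h8 : 0 < w ^ (-(1 / 4) : ℝ) := Real.rpow_pos_of_pos hw _
    have hl : 0 ≤ -Real.log w := by linarith [Real.log_nonpos hw.le h]
    calc w ^ (-β) - 1 = w ^ (-β) * (1 - w ^ β) := by rw [mul_sub, h6]; ring
      _ ≤ w ^ (-β) * (β * (-Real.log w)) := by gcongr; linarith
      _ ≤ w ^ (-(1 / 4) : ℝ) * (β * (w ^ (-(1 / 4) : ℝ) / (1 / 4))) := by gcongr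
      _ = β * (4 * (w ^ (-(1 / 4) : ℝ) * w ^ (-(1 / 4) : ℝ))) := by ring
      _ ≤ _ := by rw [h7]; gcongr; linarith

noncomputable def kk : ℝ → ℝ := Set.indicator (Set.Ioc 0 1) (fun u => u ^ (-(1 / 2) : ℝ))

lemma kk_integrable : Integrable kk := by
  unfold kk
  rw [integrable_indicator_iff measurableSet_Ioc,
    ← intervalIntegrable_iff_integrableOn_Ioc_of_le zero_le_one]
  exact intervalIntegral.intervalIntegrable_rpow' (by norm_num)

lemma kk_nonneg (u : ℝ) : 0 ≤ kk u :=
  Set.indicator_nonneg (fun x hx => Real.rpow_nonneg hx.1.le _) u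

lemma kk_bound (v : ℝ) (hv : v ≠ 0) : |v| ^ (-(1 / 2) : ℝ) ≤ 1 + (kk v + kk (-v)) := by
  have hv' := abs_pos.2 hv
  have := kk_nonneg v
  have := kk_nonneg (-v)
  rcases le_total 1 |v| with h | h
  · have := Real.rpow_le_one_of_one_le_of_nonpos h (z := -(1 / 2)) (by norm_num)
    linarith
  · have key : kk |v| = |v| ^ (-(1 / 2) : ℝ) := Set.indicator_of_mem (Set.mem_Ioc.2 ⟨hv', h⟩) _
    rw [← key]
    rcases abs_choice v with h | h <;> rw [h] <;> linarith

lemma w_bound (y z β : ℝ) (hyz : y - z ≠ 0) (hβ : 0 < β) (hβ' : β ≤ 1 / 4) :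
    |(|y - z| / (1 + |y|)) ^ (-β) - 1| ≤
      β * ((1 + |z|) * (9 + 4 * (kk (y - z) + kk (-(y - z))))) := by
  have hv := abs_pos.2 hyz
  have hy0 := abs_nonneg y
  have hz0 := abs_nonneg z
  set v := |y - z| with hvdef
  have hvle : v ≤ |y| + |z| := abs_sub y z
  have hyle : |y| ≤ v + |z| := by
    have := abs_add_le (y - z) z
    simpa using this
  refine (rpow_sub_one_bound _ β (by positivity) hβ hβ').trans ?_
  have h1 : v / (1 + |y|) ≤ 1 + |z| := by
    rw [div_le_iff₀ (by positivity)]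
    nlinarith
  have h2 : (v / (1 + |y|)) ^ (-(1 / 2) : ℝ) ≤ (1 + |z|) * (1 + v ^ (-(1 / 2) : ℝ)) := by
    rw [Real.rpow_neg (by positivity), Real.rpow_neg (by positivity), ← Real.sqrt_eq_rpow,
      ← Real.sqrt_eq_rpow, ← Real.sqrt_inv, inv_div, ← Real.sqrt_inv]
    apply Real.sqrt_le_iff.2
    refine ⟨by positivity, ?_⟩
    have hs : √(v⁻¹) ^ 2 = v⁻¹ := Real.sq_sqrt (by positivity)
    have hs0 : 0 ≤ √(v⁻¹) := Real.sqrt_nonneg _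
    have h3 : (1 + |y|) / v ≤ (1 + |z|) * (1 + v⁻¹) := by
      rw [div_le_iff₀ hv]
      have : (1 + |z|) * (1 + v⁻¹) * v = (1 + |z|) * (v + 1) := by field_simp
      rw [this]
      nlinarith
    have h4 : 1 + v⁻¹ ≤ (1 + √(v⁻¹)) ^ 2 := by nlinarith
    calc (1 + |y|) / v ≤ (1 + |z|) * (1 + v⁻¹) := h3
      _ ≤ (1 + |z|) ^ 2 * (1 + √(v⁻¹)) ^ 2 := by
        gcongr
        nlinarith
      _ = _ := by ring
  have h3 := kk_bound (y - z) hyz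
  rw [← hvdef] at h3
  have h4 : (1 + |z|) * (1 + v ^ (-(1 / 2) : ℝ)) ≤
      (1 + |z|) * (2 + (kk (y - z) + kk (-(y - z)))) := by
    exact mul_le_mul_of_nonneg_left (by linarith) (by positivity)
  apply mul_le_mul_of_nonneg_left _ hβ.le
  linarith

/-- global positivity for the one-dimensional biharmonic heat equation with
initial datum `u_0(x) = |x|^{-β}`, for all sufficiently small `β > 0`. -/
theorem biharmonic_global_positivity_dim_one
    (α : ℝ) (hα : 0 < α) (hαdef : α⁻¹ = ∫ x : ℝ, fmn 2 1 |x|) :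
    ∃ β₀ > (0 : ℝ), ∀ β : ℝ, 0 < β → β < β₀ →
      ∀ (x t : ℝ), 0 < t →
        0 < α * ∫ z : ℝ, fmn 2 1 |z| * |x - t ^ ((1 : ℝ) / 4) * z| ^ (-β) := by
  set G : ℝ → ℝ := fun z => fmn 2 1 |z| with hG
  have hpos : 0 < ∫ z, G z := by rw [← hαdef]; positivity
  have hGi : Integrable G := by
    by_contra h
    rw [integral_undef h] at hpos
    exact lt_irrefl _ hpos
  obtain ⟨C, hC, hdec⟩ := fmn_decay
  set B : ℝ → ℝ → ℝ := fun y z => C * (9 * (1 + z ^ 2)⁻¹ + 4 * (kk (y - z) + kk (-(y - z))))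
    with hB
  have hki : Integrable (fun u => kk u + kk (-u)) := kk_integrable.add kk_integrable.comp_neg
  have hBi : ∀ y, Integrable (B y) := fun y =>
    ((integrable_inv_one_add_sq.const_mul 9).add ((hki.comp_sub_left y).const_mul 4)).const_mul C
  set K : ℝ := C * (9 * π + 4 * ∫ u, (kk u + kk (-u))) with hK
  have hBK : ∀ y, ∫ z, B y z = K := by
    intro y
    simp only [hB]
    rw [integral_const_mul, integral_add (integrable_inv_one_add_sq.const_mul 9)
      ((hki.comp_sub_left y).const_mul 4), integral_const_mul, integral_const_mul,
      integral_univ_inv_one_add_sq,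
      integral_sub_left_eq_self (fun u => kk u + kk (-u)) volume y]
  have hKpos : 0 < K := by
    have : 0 ≤ ∫ u, (kk u + kk (-u)) :=
      integral_nonneg fun u => add_nonneg (kk_nonneg _) (kk_nonneg _)
    have := Real.pi_pos
    positivity
  refine ⟨min (1 / 4) ((∫ z, G z) / K), by positivity, fun β hβ hβ' x t ht => ?_⟩
  have hβ4 : β ≤ 1 / 4 := (hβ'.trans_le (min_le_left _ _)).le
  have hβK : β * K < ∫ z, G z := (lt_div_iff₀ hKpos).1 (hβ'.trans_le (min_le_right _ _))
  apply mul_pos hα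
  set τ := t ^ ((1 : ℝ) / 4) with hτ
  have hτ0 : 0 < τ := Real.rpow_pos_of_pos ht _
  set y := x / τ with hy
  set N := τ * (1 + |y|) with hN
  have hN0 : 0 < N := by positivity
  set W : ℝ → ℝ := fun z => (|y - z| / (1 + |y|)) ^ (-β) with hW
  have hrew : ∀ z, G z * |x - τ * z| ^ (-β) = N ^ (-β) * (G z * W z) := by
    intro z
    have : |x - τ * z| = N * (|y - z| / (1 + |y|)) := by
      have e : x - τ * z = τ * (y - z) := by rw [hy]; field_simp
      have : 0 < 1 + |y| := by positivity
      rw [e, abs_mul, abs_of_pos hτ0, hN]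
      field_simp
    rw [this, Real.mul_rpow hN0.le (by positivity)]
    ring
  have hbd : ∀ᵐ z : ℝ, ‖G z * (W z - 1)‖ ≤ β * B y z := by
    have h0 : ∀ᵐ z : ℝ, z ≠ 0 := by simp [ae_iff]
    have h1 : ∀ᵐ z : ℝ, z ≠ y := by simp [ae_iff]
    filter_upwards [h0, h1] with z hz hzy
    have hb := w_bound y z β (sub_ne_zero.2 hzy.symm) hβ hβ4
    have hd := hdec z hz
    have hq : (1 + z ^ 2)⁻¹ ≤ 1 := inv_le_one_of_one_le₀ (by nlinarith)
    have hq0 : 0 < (1 + z ^ 2)⁻¹ := by positivity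
    have k1 := kk_nonneg (y - z)
    have k2 := kk_nonneg (-(y - z))
    rw [Real.norm_eq_abs, abs_mul]
    calc |G z| * |W z - 1|
        ≤ |G z| * (β * ((1 + |z|) * (9 + 4 * (kk (y - z) + kk (-(y - z)))))) := by gcongr
      _ = β * ((|G z| * (1 + |z|)) * (9 + 4 * (kk (y - z) + kk (-(y - z))))) := by ring
      _ ≤ β * ((C * (1 + z ^ 2)⁻¹) * (9 + 4 * (kk (y - z) + kk (-(y - z))))) := by gcongr
      _ = β * (C * (9 * (1 + z ^ 2)⁻¹ +
            4 * ((1 + z ^ 2)⁻¹ * (kk (y - z) + kk (-(y - z)))))) := by ring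
      _ ≤ β * (C * (9 * (1 + z ^ 2)⁻¹ + 4 * (1 * (kk (y - z) + kk (-(y - z)))))) := by gcongr
      _ = _ := by simp only [hB, one_mul]
  have hWm : Measurable W := by fun_prop
  have hdi : Integrable (fun z => G z * (W z - 1)) :=
    ((hBi y).const_mul β).mono' (hGi.1.mul (hWm.sub_const 1).aestronglyMeasurable) hbd
  have hle : ‖∫ z, G z * (W z - 1)‖ ≤ β * K := by
    rw [← hBK y, ← integral_const_mul]
    exact norm_integral_le_of_norm_le ((hBi y).const_mul β) hbd
  have hsum : ∫ z, G z * W z = (∫ z, G z) + ∫ z, G z * (W z - 1) := by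
    rw [← integral_add hGi hdi]
    congr 1
    ext z
    ring
  have hfin : 0 < ∫ z, G z * W z := by
    rw [hsum]
    rw [Real.norm_eq_abs] at hle
    have := neg_abs_le (∫ z, G z * (W z - 1))
    linarith
  have : ∫ z, G z * |x - τ * z| ^ (-β) = N ^ (-β) * ∫ z, G z * W z := by
    rw [← integral_const_mul]
    exact integral_congr_ae (Eventually.of_forall hrew)
  change 0 < ∫ z, G z * |x - τ * z| ^ (-β)
  rw [this]
  exact mul_pos (Real.rpow_pos_of_pos hN0 _) hfin
end

section
/- Let n ≥ 1 and β ∈ (0, n). For every T > 1 there exists g ∈ C_β such that, taking u_0(x) = 1/(g(x) + |x|^β) and letting u(x,t) = α_n ∫_{ℝ^n} f_n(|z|) u_0(x − t^{1/4} z) dz be the solution of the biharmonic heat equation u_t + Δ²u = 0 with datum u_0, there exists a point x_T ∈ ℝ^n with u(x_T, T) < 0. -/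
open MeasureTheory Real Filter Topology

namespace Biharm

noncomputable def M (m k : ℕ) : ℝ := ∫ s in Set.Ioi (0 : ℝ), Real.exp (-(s ^ 4)) * s ^ (m + 2 * k)

lemma int_gauss (p : ℕ) {b : ℝ} (hb : 0 < b) :
    IntegrableOn (fun s : ℝ => s ^ p * Real.exp (-b * s ^ 2)) (Set.Ioi 0) := by
  have h := integrableOn_rpow_mul_exp_neg_mul_sq (s := (p : ℝ)) hb
    (by have : (0 : ℝ) ≤ p := Nat.cast_nonneg p
        linarith)
  simpa using h

lemma int_qg (p : ℕ) (x : ℝ) :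
    IntegrableOn (fun s : ℝ => Real.exp (-(s ^ 4)) * s ^ p * Real.exp (x * s ^ 2)) (Set.Ioi 0) := by
  have h := (int_gauss p one_pos).const_mul (Real.exp ((x + 1) ^ 2 / 4))
  refine Integrable.mono' h (by fun_prop) ?_
  filter_upwards [ae_restrict_mem measurableSet_Ioi] with s hs
  have hs : 0 < s := hs
  rw [Real.norm_of_nonneg (by positivity)]
  have : Real.exp (-(s ^ 4)) * s ^ p * Real.exp (x * s ^ 2)
      = s ^ p * Real.exp (-(s ^ 4) + x * s ^ 2) := by rw [Real.exp_add]; ring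
  rw [this]
  have h2 : Real.exp ((x + 1) ^ 2 / 4) * (s ^ p * Real.exp (-1 * s ^ 2))
      = s ^ p * Real.exp ((x + 1) ^ 2 / 4 + -1 * s ^ 2) := by rw [Real.exp_add]; ring
  rw [h2]
  refine mul_le_mul_of_nonneg_left (Real.exp_le_exp.mpr ?_) (by positivity)
  nlinarith [sq_nonneg (s ^ 2 - (x + 1) / 2)]

lemma int_q (p : ℕ) :
    IntegrableOn (fun s : ℝ => Real.exp (-(s ^ 4)) * s ^ p) (Set.Ioi 0) := by
  simpa using int_qg p 0

lemma M_nonneg (m k : ℕ) : 0 ≤ M m k := by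
  refine setIntegral_nonneg measurableSet_Ioi fun s hs => ?_
  have hs : 0 < s := hs
  positivity

lemma summ_M (m : ℕ) {x : ℝ} (hx : 0 ≤ x) :
    Summable (fun k : ℕ => x ^ k / k.factorial * M m k) := by
  refine summable_of_sum_le (c := ∫ s in Set.Ioi (0 : ℝ),
    Real.exp (-(s ^ 4)) * s ^ m * Real.exp (x * s ^ 2)) (fun k => ?_) (fun u => ?_)
  · have := M_nonneg m k
    positivity
  · have : ∑ k ∈ u, x ^ k / k.factorial * M m k = ∫ s in Set.Ioi (0 : ℝ),
        ∑ k ∈ u, x ^ k / k.factorial * (Real.exp (-(s ^ 4)) * s ^ (m + 2 * k)) := by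
      rw [integral_finsetSum]
      · simp only [M, integral_const_mul]
      · intro k _
        exact (int_q _).const_mul _
    rw [this]
    refine setIntegral_mono_on ?_ (int_qg m x) measurableSet_Ioi ?_
    · exact integrable_finsetSum _ fun k _ => (int_q _).const_mul _
    · intro s hs
      have hs : 0 < s := hs
      have h1 : ∑ k ∈ u, x ^ k / k.factorial * (Real.exp (-(s ^ 4)) * s ^ (m + 2 * k))
        = Real.exp (-(s ^ 4)) * s ^ m * ∑ k ∈ u, (x * s ^ 2) ^ k / k.factorial := by
        rw [Finset.mul_sum]
        refine Finset.sum_congr rfl fun k _ => ?_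
        rw [mul_pow, pow_add, pow_mul]; ring
      rw [h1]
      gcongr
      have h2 : HasSum (fun k : ℕ => (x * s ^ 2) ^ k / k.factorial) (Real.exp (x * s ^ 2)) := by
        rw [Real.exp_eq_exp_ℝ]
        exact NormedSpace.expSeries_div_hasSum_exp _
      exact sum_le_hasSum _ (fun k _ => by positivity) h2

noncomputable def G (m k : ℕ) : ℝ := Real.Gamma (((m : ℝ) + 2 * k + 1) / 2)

lemma G_pos (m k : ℕ) : 0 < G m k := Real.Gamma_pos_of_pos (by positivity)

lemma G_lower (m : ℕ) : ∃ c > 0, ∀ k, c ≤ G m k := by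
  have hrec : ∀ k, G m (k + 1) = (((m : ℝ) + 2 * k + 1) / 2) * G m k := by
    intro k
    unfold G
    rw [← Real.Gamma_add_one (by positivity)]
    congr 1
    push_cast; ring
  refine ⟨min (G m 0) (G m 1), lt_min (G_pos _ _) (G_pos _ _), ?_⟩
  intro k
  rcases k with _ | k
  · exact min_le_left _ _
  · refine (min_le_right _ _).trans ?_
    induction k with
    | zero => exact le_rfl
    | succ k ih =>
      rw [hrec (k + 1)]
      refine ih.trans (le_mul_of_one_le_left (G_pos _ _).le ?_)
      have : (0 : ℝ) ≤ m := by positivity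
      have : (0 : ℝ) ≤ k := by positivity
      push_cast; linarith

noncomputable def D (m : ℕ) : ℝ := (2 : ℝ) ^ (-(((m : ℝ) - 1) / 2))

lemma D_pos (m : ℕ) : 0 < D m := by unfold D; positivity

noncomputable def b (m k : ℕ) : ℝ := (-1) ^ k * D m / (4 ^ k * k.factorial * G m k)

lemma norm_b (m k : ℕ) : ‖b m k‖ = D m / (4 ^ k * k.factorial * G m k) := by
  have := D_pos m
  have := G_pos m k
  unfold b
  rw [norm_div, norm_mul, norm_pow, norm_neg, norm_one, one_pow, one_mul,
    Real.norm_of_nonneg (by positivity), Real.norm_of_nonneg (by positivity)]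

lemma bessel_eq (m : ℕ) {y : ℝ} (hy : 0 < y) :
    y ^ (((m + 1 : ℕ) : ℝ) / 2) * besselJ ((((m + 1 : ℕ) : ℝ) - 2) / 2) y
      = ∑' k : ℕ, b m k * y ^ (m + 2 * k) := by
  unfold besselJ
  rw [← tsum_mul_left]
  refine tsum_congr fun k => ?_
  have hG : Real.Gamma ((k : ℝ) + (((m + 1 : ℕ) : ℝ) - 2) / 2 + 1) = G m k := by
    unfold G; congr 1; push_cast; ring
  rw [hG]
  have h1 : (y / 2) ^ ((2 * k : ℝ) + (((m + 1 : ℕ) : ℝ) - 2) / 2)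
      = y ^ ((2 * k : ℝ) + (((m + 1 : ℕ) : ℝ) - 2) / 2) * (D m / 4 ^ k) := by
    rw [Real.div_rpow hy.le (by norm_num), div_eq_mul_inv, ← Real.rpow_neg (by norm_num)]
    congr 1
    unfold D
    rw [show -((2 * k : ℝ) + (((m + 1 : ℕ) : ℝ) - 2) / 2) = -(((m : ℝ) - 1) / 2) - (2 * k : ℝ) by
      push_cast; ring, Real.rpow_sub (by norm_num), Real.rpow_mul (by norm_num), Real.rpow_natCast]
    norm_num
  have h2 : y ^ (((m + 1 : ℕ) : ℝ) / 2) * y ^ ((2 * k : ℝ) + (((m + 1 : ℕ) : ℝ) - 2) / 2)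
      = y ^ (m + 2 * k) := by
    rw [← Real.rpow_add hy, ← Real.rpow_natCast]
    congr 1
    push_cast; ring
  rw [h1, ← h2, b]
  ring

lemma summ_bM (m : ℕ) (η : ℝ) : Summable (fun k => ‖b m k‖ * M m k * η ^ (2 * k)) := by
  obtain ⟨c, hc, hcG⟩ := G_lower m
  have hs := (summ_M m (x := η ^ 2 / 4) (by positivity)).mul_left (D m / c)
  refine Summable.of_nonneg_of_le (fun k => ?_) (fun k => ?_) hs
  · have := M_nonneg m k
    have := (even_two_mul k).pow_nonneg η
    positivity
  · rw [norm_b]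
    have := M_nonneg m k
    have hD := D_pos m
    calc D m / (4 ^ k * k.factorial * G m k) * M m k * η ^ (2 * k)
        = D m / G m k * ((η ^ 2 / 4) ^ k / k.factorial * M m k) := by
          rw [div_pow, ← pow_mul]; field_simp
      _ ≤ _ := by
          gcongr
          exact hcG k

lemma f_series (m : ℕ) {η : ℝ} (hη : 0 < η) :
    η ^ m * fmn 2 (m + 1) η = ∑' k : ℕ, b m k * M m k * η ^ (m + 2 * k) := by
  unfold fmn
  have h0 : η ^ m * η ^ ((1 : ℝ) - (m + 1 : ℕ)) = 1 := by
    rw [← Real.rpow_natCast, ← Real.rpow_add hη]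
    push_cast
    simp
  rw [← mul_assoc, h0, one_mul]
  have h1 : ∫ s in Set.Ioi (0 : ℝ), Real.exp (-(s ^ (2 * 2))) * (η * s) ^ (((m + 1 : ℕ) : ℝ) / 2) *
        besselJ ((((m + 1 : ℕ) : ℝ) - 2) / 2) (η * s)
      = ∫ s in Set.Ioi (0 : ℝ), ∑' k : ℕ,
        (b m k * η ^ (m + 2 * k)) * (Real.exp (-(s ^ 4)) * s ^ (m + 2 * k)) := by
    refine setIntegral_congr_fun measurableSet_Ioi fun s hs => ?_
    have hs : 0 < s := hs
    rw [mul_assoc, bessel_eq m (mul_pos hη hs), ← tsum_mul_left]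
    refine tsum_congr fun k => ?_
    rw [mul_pow]; ring
  rw [h1, ← integral_tsum_of_summable_integral_norm]
  · refine tsum_congr fun k => ?_
    rw [integral_const_mul]
    change _ * M m k = _
    ring
  · exact fun k => (int_q _).const_mul _
  · have : ∀ k, ∫ s in Set.Ioi (0 : ℝ),
        ‖(b m k * η ^ (m + 2 * k)) * (Real.exp (-(s ^ 4)) * s ^ (m + 2 * k))‖
        = η ^ m * (‖b m k‖ * M m k * η ^ (2 * k)) := by
      intro k
      have : ∫ s in Set.Ioi (0 : ℝ),
        ‖(b m k * η ^ (m + 2 * k)) * (Real.exp (-(s ^ 4)) * s ^ (m + 2 * k))‖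
        = ∫ s in Set.Ioi (0 : ℝ),
        (‖b m k‖ * η ^ (m + 2 * k)) * (Real.exp (-(s ^ 4)) * s ^ (m + 2 * k)) := by
        refine setIntegral_congr_fun measurableSet_Ioi fun s hs => ?_
        have hs : 0 < s := hs
        rw [norm_mul, norm_mul, Real.norm_of_nonneg (r := η ^ _) (by positivity),
          Real.norm_of_nonneg (r := Real.exp _ * _) (by positivity)]
      rw [this, integral_const_mul]
      change _ * M m k = _
      ring
    simp_rw [this]
    exact (summ_bM m η).mul_left _

lemma gauss_val (m k : ℕ) {a : ℝ} (ha : 0 < a) :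
    ∫ s in Set.Ioi (0 : ℝ), s ^ (m + 2 * k) * Real.exp (-(a ^ 2 / 4) * s ^ 2)
      = (2 / a) ^ (m + 1) * (4 / a ^ 2) ^ k * (1 / 2) * G m k := by
  have h := integral_rpow_mul_exp_neg_mul_rpow (p := 2) (q := ((m + 2 * k : ℕ) : ℝ))
    (b := a ^ 2 / 4) two_pos
    (by have : (0 : ℝ) ≤ ((m + 2 * k : ℕ) : ℝ) := Nat.cast_nonneg _
        linarith) (by positivity)
  simp only [Real.rpow_natCast, Real.rpow_two] at h
  rw [h]
  have h1 : (a ^ 2 / 4) ^ (-(((m + 2 * k : ℕ) : ℝ) + 1) / 2) = (2 / a) ^ (m + 1) * (4 / a ^ 2) ^ k := by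
    have e1 : a ^ 2 / 4 = (2 / a) ^ (-2 : ℝ) := by
      rw [Real.rpow_neg (by positivity), Real.rpow_two, div_pow, inv_div]; norm_num
    have e2 : 4 / a ^ 2 = (2 / a) ^ 2 := by rw [div_pow]; norm_num
    rw [e1, e2, ← Real.rpow_mul (by positivity), ← pow_mul, ← pow_add, ← Real.rpow_natCast]
    congr 1
    push_cast; ring
  rw [h1]
  unfold G
  push_cast
  rfl

lemma weber (m : ℕ) {a : ℝ} (ha : 0 < a) :
    ∫ η in Set.Ioi (0 : ℝ), η ^ m * (fmn 2 (m + 1) η * Real.exp (-(a ^ 2 / 4) * η ^ 2))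
      = D m * 2 ^ m * ∫ r in Set.Ioi (0 : ℝ), Real.exp (-(a * r) ^ 4) * r ^ m * Real.exp (-r ^ 2) := by
  have hD := D_pos m
  have h1 : ∫ η in Set.Ioi (0 : ℝ), η ^ m * (fmn 2 (m + 1) η * Real.exp (-(a ^ 2 / 4) * η ^ 2))
      = ∫ η in Set.Ioi (0 : ℝ), ∑' k : ℕ,
        (b m k * M m k) * (η ^ (m + 2 * k) * Real.exp (-(a ^ 2 / 4) * η ^ 2)) := by
    refine setIntegral_congr_fun measurableSet_Ioi fun s hs => ?_
    rw [← mul_assoc, f_series m hs, ← tsum_mul_right]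
    refine tsum_congr fun k => ?_
    ring
  have key : ∀ k, ‖b m k‖ * M m k * ((2 / a) ^ (m + 1) * (4 / a ^ 2) ^ k * (1 / 2) * G m k)
      = D m * (2 / a) ^ (m + 1) * (1 / 2) * ((1 / a ^ 2) ^ k / k.factorial * M m k) := by
    intro k
    have := G_pos m k
    rw [norm_b, div_pow 4, div_pow 1, one_pow]
    field_simp
  rw [h1, ← integral_tsum_of_summable_integral_norm]
  rotate_left
  · exact fun k => (int_gauss _ (by positivity)).const_mul _
  · have : ∀ k, ∫ s in Set.Ioi (0 : ℝ),
        ‖(b m k * M m k) * (s ^ (m + 2 * k) * Real.exp (-(a ^ 2 / 4) * s ^ 2))‖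
        = D m * (2 / a) ^ (m + 1) * (1 / 2) * ((1 / a ^ 2) ^ k / k.factorial * M m k) := by
      intro k
      rw [← key, ← gauss_val m k ha, ← integral_const_mul]
      refine setIntegral_congr_fun measurableSet_Ioi fun s hs => ?_
      have hs : 0 < s := hs
      rw [norm_mul, norm_mul, Real.norm_of_nonneg (M_nonneg m k),
          Real.norm_of_nonneg (r := s ^ _ * _) (by positivity)]
    simp_rw [this]
    exact (summ_M m (by positivity)).mul_left _
  have h2 : ∀ k, ∫ s in Set.Ioi (0 : ℝ),
        (b m k * M m k) * (s ^ (m + 2 * k) * Real.exp (-(a ^ 2 / 4) * s ^ 2))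
        = D m * (2 / a) ^ (m + 1) * (1 / 2) * ∫ s in Set.Ioi (0 : ℝ),
          ((-1 / a ^ 2) ^ k / k.factorial) * (Real.exp (-(s ^ 4)) * s ^ (m + 2 * k)) := by
    intro k
    have := G_pos m k
    rw [integral_const_mul, integral_const_mul, gauss_val m k ha]
    change _ = _ * (_ * M m k)
    rw [b, div_pow 4, div_pow (-1)]
    field_simp
  simp_rw [h2]
  rw [tsum_mul_left, integral_tsum_of_summable_integral_norm]
  rotate_left
  · exact fun k => (int_q _).const_mul _
  · have : ∀ k : ℕ, ∫ s in Set.Ioi (0 : ℝ),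
        ‖((-1 / a ^ 2) ^ k / k.factorial) * (Real.exp (-(s ^ 4)) * s ^ (m + 2 * k))‖
        = (1 / a ^ 2) ^ k / k.factorial * M m k := by
      intro k
      rw [M, ← integral_const_mul]
      refine setIntegral_congr_fun measurableSet_Ioi fun s hs => ?_
      have hs : 0 < s := hs
      rw [norm_mul, Real.norm_of_nonneg (r := Real.exp _ * _) (by positivity), norm_div, norm_pow,
        norm_div, norm_neg, norm_one, Real.norm_of_nonneg (r := a ^ 2) (by positivity),
        Real.norm_of_nonneg (r := (k.factorial : ℝ)) (by positivity)]
    simp_rw [this]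
    exact summ_M m (by positivity)
  have h3 : ∫ s in Set.Ioi (0 : ℝ), ∑' k : ℕ,
        ((-1 / a ^ 2) ^ k / k.factorial) * (Real.exp (-(s ^ 4)) * s ^ (m + 2 * k))
      = ∫ s in Set.Ioi (0 : ℝ), Real.exp (-(s ^ 4)) * s ^ m * Real.exp (-(s / a) ^ 2) := by
    refine setIntegral_congr_fun measurableSet_Ioi fun s hs => ?_
    have h2 : HasSum (fun k : ℕ => (-(s / a) ^ 2) ^ k / k.factorial) (Real.exp (-(s / a) ^ 2)) := by
      rw [Real.exp_eq_exp_ℝ]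
      exact NormedSpace.expSeries_div_hasSum_exp _
    rw [← h2.tsum_eq, ← tsum_mul_left]
    refine tsum_congr fun k => ?_
    rw [show -(s / a) ^ 2 = (-1 / a ^ 2) * s ^ 2 by field_simp, mul_pow, pow_add, pow_mul]
    ring
  rw [h3]
  have h4 := integral_comp_mul_left_Ioi' (fun s => Real.exp (-(s ^ 4)) * s ^ m * Real.exp (-(s / a) ^ 2)) 0 ha
  rw [mul_zero] at h4
  rw [← h4, smul_eq_mul]
  have h5 : ∫ x in Set.Ioi (0 : ℝ), Real.exp (-((a * x) ^ 4)) * (a * x) ^ m * Real.exp (-(a * x / a) ^ 2)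
     = a ^ m * ∫ r in Set.Ioi (0 : ℝ), Real.exp (-(a * r) ^ 4) * r ^ m * Real.exp (-r ^ 2) := by
    rw [← integral_const_mul]
    refine setIntegral_congr_fun measurableSet_Ioi fun s hs => ?_
    rw [mul_div_cancel_left₀ _ ha.ne', mul_pow a s m]
    ring
  rw [h5, div_pow, pow_succ, pow_succ]
  field_simp

lemma weber_diff (m : ℕ) : ∃ C : ℝ, ∀ a : ℝ, 0 < a →
    (∫ η in Set.Ioi (0 : ℝ), η ^ m * (fmn 2 (m + 1) η * Real.exp (-(a ^ 2 / 4) * η ^ 2)))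
    - (∫ η in Set.Ioi (0 : ℝ), η ^ m * (fmn 2 (m + 1) η * Real.exp (-((2 * a) ^ 2 / 4) * η ^ 2)))
      ≤ C * a ^ 4 := by
  have hD := D_pos m
  refine ⟨D m * 2 ^ m * (16 * ∫ r in Set.Ioi (0 : ℝ), r ^ (m + 4) * Real.exp (-1 * r ^ 2)), ?_⟩
  intro a ha
  have hint : ∀ c : ℝ, IntegrableOn (fun r : ℝ => Real.exp (-(c * r) ^ 4) * r ^ m * Real.exp (-r ^ 2))
      (Set.Ioi 0) := by
    intro c
    refine Integrable.mono' (int_gauss m one_pos) (by fun_prop) ?_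
    filter_upwards [ae_restrict_mem measurableSet_Ioi] with s hs
    have hs : 0 < s := hs
    rw [Real.norm_of_nonneg (by positivity), mul_assoc]
    have h1 : Real.exp (-(c * s) ^ 4) ≤ 1 := Real.exp_le_one_iff.mpr (by
      have : 0 ≤ (c * s) ^ 4 := by positivity
      linarith)
    have h2 : -s ^ 2 = -1 * s ^ 2 := by ring
    rw [h2]
    exact mul_le_of_le_one_left (by positivity) h1
  rw [weber m ha, weber m (by positivity : 0 < 2 * a), ← mul_sub, ← integral_sub (hint _) (hint _),
    mul_assoc]
  rw [mul_assoc (D m * 2 ^ m) _ (a ^ 4), mul_assoc (D m)]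
  refine mul_le_mul_of_nonneg_left ?_ hD.le
  refine mul_le_mul_of_nonneg_left ?_ (by positivity)
  rw [mul_right_comm, ← integral_const_mul]
  refine setIntegral_mono_on ((hint _).sub (hint _)) ((int_gauss (m + 4) one_pos).const_mul _)
    measurableSet_Ioi ?_
  intro s hs
  have hs : 0 < s := hs
  have h1 : Real.exp (-(a * s) ^ 4) ≤ 1 := Real.exp_le_one_iff.mpr (by
      have : 0 ≤ (a * s) ^ 4 := by positivity
      linarith)
  have h2 := Real.add_one_le_exp (-(2 * a * s) ^ 4)
  have h3 : Real.exp (-(a * s) ^ 4) - Real.exp (-(2 * a * s) ^ 4) ≤ 16 * a ^ 4 * s ^ 4 := by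
    nlinarith
  have h4 : Real.exp (-(a * s) ^ 4) * s ^ m * Real.exp (-s ^ 2)
      - Real.exp (-(2 * a * s) ^ 4) * s ^ m * Real.exp (-s ^ 2)
      = (Real.exp (-(a * s) ^ 4) - Real.exp (-(2 * a * s) ^ 4)) * (s ^ m * Real.exp (-1 * s ^ 2)) := by
    rw [neg_one_mul]; ring
  rw [h4]
  refine (mul_le_mul_of_nonneg_right h3 (by positivity)).trans (le_of_eq ?_)
  ring

lemma not_nonneg (m : ℕ) (hint : Integrable (fun x : EuclideanSpace ℝ (Fin (m + 1)) => fmn 2 (m + 1) ‖x‖))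
    (hpos : 0 < ∫ x : EuclideanSpace ℝ (Fin (m + 1)), fmn 2 (m + 1) ‖x‖)
    (h0 : ∀ᵐ x : EuclideanSpace ℝ (Fin (m + 1)), 0 ≤ fmn 2 (m + 1) ‖x‖) : False := by
  obtain ⟨C, hC⟩ := weber_diff m
  set κ : ℝ := ((m : ℝ) + 1) * volume.real (Metric.ball (0 : EuclideanSpace ℝ (Fin (m + 1))) 1)
  have hκ : 0 ≤ κ := by positivity
  have hrad : ∀ a : ℝ, ∫ x : EuclideanSpace ℝ (Fin (m + 1)),
      fmn 2 (m + 1) ‖x‖ * Real.exp (-(a ^ 2 / 4) * ‖x‖ ^ 2)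
      = κ * ∫ η in Set.Ioi (0 : ℝ), η ^ m * (fmn 2 (m + 1) η * Real.exp (-(a ^ 2 / 4) * η ^ 2)) := by
    intro a
    rw [integral_fun_norm_addHaar volume (fun y => fmn 2 (m + 1) y * Real.exp (-(a ^ 2 / 4) * y ^ 2))]
    simp [κ, mul_assoc]
  have hI : ∀ a : ℝ, Integrable (fun x : EuclideanSpace ℝ (Fin (m + 1)) =>
      fmn 2 (m + 1) ‖x‖ * Real.exp (-(a ^ 2 / 4) * ‖x‖ ^ 2)) := by
    intro a
    refine hint.mul_bdd (c := 1) (by fun_prop) (Eventually.of_forall fun x => ?_)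
    rw [Real.norm_of_nonneg (by positivity)]
    refine Real.exp_le_one_iff.mpr ?_
    have : 0 ≤ (a ^ 2 / 4) * ‖x‖ ^ 2 := by positivity
    linarith
  have hI2 : Integrable (fun x : EuclideanSpace ℝ (Fin (m + 1)) =>
      fmn 2 (m + 1) ‖x‖ * (‖x‖ ^ 2 * Real.exp (-‖x‖ ^ 2))) := by
    refine hint.mul_bdd (c := 1) (by fun_prop) (Eventually.of_forall fun x => ?_)
    rw [Real.norm_of_nonneg (by positivity), Real.exp_neg, ← div_eq_mul_inv]
    refine div_le_one_of_le₀ ?_ (by positivity)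
    linarith [Real.add_one_le_exp (‖x‖ ^ 2)]
  have hbound : ∀ a : ℝ, 0 < a → a ≤ 1 → ∫ x : EuclideanSpace ℝ (Fin (m + 1)),
      fmn 2 (m + 1) ‖x‖ * (‖x‖ ^ 2 * Real.exp (-‖x‖ ^ 2)) ≤ 4 * κ * C * a ^ 2 := by
    intro a ha ha1
    have h1 : (a ^ 2 / 4) * ∫ x : EuclideanSpace ℝ (Fin (m + 1)),
        fmn 2 (m + 1) ‖x‖ * (‖x‖ ^ 2 * Real.exp (-‖x‖ ^ 2)) ≤ κ * (C * a ^ 4) := by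
      calc _ ≤ (∫ x : EuclideanSpace ℝ (Fin (m + 1)),
              fmn 2 (m + 1) ‖x‖ * Real.exp (-(a ^ 2 / 4) * ‖x‖ ^ 2))
            - ∫ x : EuclideanSpace ℝ (Fin (m + 1)),
              fmn 2 (m + 1) ‖x‖ * Real.exp (-((2 * a) ^ 2 / 4) * ‖x‖ ^ 2) := by
            rw [← integral_sub (hI _) (hI _), ← integral_const_mul]
            refine integral_mono_ae (hI2.const_mul _) ((hI _).sub (hI _)) ?_
            filter_upwards [h0] with x hx
            rw [← mul_sub, mul_left_comm]
            refine mul_le_mul_of_nonneg_left ?_ hx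
            set q := ‖x‖ ^ 2
            have hq : 0 ≤ q := by positivity
            set e := a ^ 2 / 4 * q with he
            have he0 : 0 ≤ e := by positivity
            have heq : 4 * e ≤ q := by
              have : a ^ 2 ≤ 1 := by nlinarith
              rw [he]; nlinarith
            have e1 : -((2 * a) ^ 2 / 4) * q = -(4 * e) := by rw [he]; ring
            have e2 : -(a ^ 2 / 4) * q = -e := by rw [he]; ring
            rw [e1, e2, ← mul_assoc, ← he]
            have h3 : Real.exp (-q) ≤ Real.exp (-(4 * e)) := Real.exp_le_exp.mpr (by linarith)
            have h4 : Real.exp (-e) = Real.exp (-(4 * e)) * Real.exp (3 * e) := by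
              rw [← Real.exp_add]; congr 1; ring
            have h5 := Real.add_one_le_exp (3 * e)
            have h6 := Real.exp_pos (-(4 * e))
            rw [h4]
            nlinarith
        _ = κ * ((∫ η in Set.Ioi (0 : ℝ), η ^ m * (fmn 2 (m + 1) η * Real.exp (-(a ^ 2 / 4) * η ^ 2)))
            - (∫ η in Set.Ioi (0 : ℝ), η ^ m * (fmn 2 (m + 1) η *
                Real.exp (-((2 * a) ^ 2 / 4) * η ^ 2)))) := by
            rw [hrad, hrad, mul_sub]
        _ ≤ _ := mul_le_mul_of_nonneg_left (hC a ha) hκ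
    have ha2 : 0 < a ^ 2 := by positivity
    have h2 : (a ^ 2 / 4) * (4 * κ * C * a ^ 2) = κ * (C * a ^ 4) := by ring
    rw [← h2] at h1
    exact le_of_mul_le_mul_left h1 (by positivity)
  have hnn : 0 ≤ᵐ[volume] (fun x : EuclideanSpace ℝ (Fin (m + 1)) =>
      fmn 2 (m + 1) ‖x‖ * (‖x‖ ^ 2 * Real.exp (-‖x‖ ^ 2))) := by
    filter_upwards [h0] with x hx
    exact mul_nonneg hx (by positivity)
  have hle : ∫ x : EuclideanSpace ℝ (Fin (m + 1)),
      fmn 2 (m + 1) ‖x‖ * (‖x‖ ^ 2 * Real.exp (-‖x‖ ^ 2)) ≤ 0 := by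
    have ht : Tendsto (fun a : ℝ => 4 * κ * C * a ^ 2) (𝓝[>] 0) (𝓝 0) := by
      have : ContinuousAt (fun a : ℝ => 4 * κ * C * a ^ 2) 0 := by fun_prop
      have h := this.tendsto
      simp only [ne_eq, OfNat.ofNat_ne_zero, not_false_eq_true, zero_pow, mul_zero] at h
      exact h.mono_left nhdsWithin_le_nhds
    refine ge_of_tendsto ht ?_
    filter_upwards [Ioc_mem_nhdsGT (zero_lt_one' ℝ)] with a ha
    exact hbound a ha.1 ha.2
  have hz := (integral_eq_zero_iff_of_nonneg_ae hnn hI2).mp (le_antisymm hle (integral_nonneg_of_ae hnn))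
  have hzz : ∀ᵐ x : EuclideanSpace ℝ (Fin (m + 1)), fmn 2 (m + 1) ‖x‖ = 0 := by
    have hne : ∀ᵐ x : EuclideanSpace ℝ (Fin (m + 1)), x ≠ 0 := by
      simp [ae_iff]
    filter_upwards [hz, hne] with x hx hx0
    have : 0 < ‖x‖ ^ 2 * Real.exp (-‖x‖ ^ 2) := by
      have := norm_pos_iff.mpr hx0
      positivity
    exact (mul_eq_zero.mp hx).resolve_right this.ne'
  rw [integral_congr_ae hzz] at hpos
  simp at hpos

lemma exists_compact (m : ℕ) (hint : Integrable (fun x : EuclideanSpace ℝ (Fin (m + 1)) => fmn 2 (m + 1) ‖x‖))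
    (hpos : 0 < ∫ x : EuclideanSpace ℝ (Fin (m + 1)), fmn 2 (m + 1) ‖x‖) :
    ∃ K : Set (EuclideanSpace ℝ (Fin (m + 1))), IsCompact K ∧ 0 < volume K ∧ (0 ∉ K) ∧
      ∀ x ∈ K, fmn 2 (m + 1) ‖x‖ < 0 := by
  set S : Set (EuclideanSpace ℝ (Fin (m + 1))) := {x | fmn 2 (m + 1) ‖x‖ < 0} with hS
  have hSn : NullMeasurableSet S := nullMeasurableSet_lt hint.aemeasurable aemeasurable_const
  have hSpos : volume S ≠ 0 := by
    intro h
    refine not_nonneg m hint hpos ?_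
    rw [ae_iff]
    simpa [hS] using h
  obtain ⟨t, htS, htm, hte⟩ := hSn.exists_measurable_subset_ae_eq
  have ht2 : 0 < volume (t \ {0}) := by
    rw [measure_sdiff_null (by simp), measure_congr hte]
    exact pos_iff_ne_zero.mpr hSpos
  obtain ⟨K, hKt, hK, hKp⟩ := (htm.diff (measurableSet_singleton 0)).exists_lt_isCompact ht2
  exact ⟨K, hK, hKp, fun h => (hKt h).2 rfl, fun x hx => htS (hKt hx).1⟩

end Biharm

/-- for `0 < β < n` and any time `T > 1` there is `g ∈ C_β` such that the
solution of the biharmonic heat equation with datum `u_0 = 1/(g+|x|^β)` is negative somewhere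
at time `T`. -/
theorem biharmonic_no_uniform_positivity_time (n : ℕ) (hn : 1 ≤ n)
    (β : ℝ) (hβ0 : 0 < β) (hβn : β < n)
    (α : ℝ) (hα : 0 < α)
    (hαdef : α⁻¹ = ∫ x : EuclideanSpace ℝ (Fin n), fmn 2 n ‖x‖)
    (T : ℝ) (hT : 1 < T) :
    ∃ g : EuclideanSpace ℝ (Fin n) → ℝ, memCbeta n β g ∧
      ∃ xT : EuclideanSpace ℝ (Fin n),
        α * (∫ z : EuclideanSpace ℝ (Fin n),
          fmn 2 n ‖z‖ *
            (1 / (g (xT - T ^ ((1 : ℝ) / 4) • z)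
              + ‖xT - T ^ ((1 : ℝ) / 4) • z‖ ^ β))) < 0 := by
  obtain ⟨m, rfl⟩ : ∃ m, n = m + 1 := ⟨n - 1, by omega⟩
  have hpos : 0 < ∫ x : EuclideanSpace ℝ (Fin (m + 1)), fmn 2 (m + 1) ‖x‖ := by
    rw [← hαdef]; positivity
  have hint : Integrable (fun x : EuclideanSpace ℝ (Fin (m + 1)) => fmn 2 (m + 1) ‖x‖) := by
    by_contra h
    rw [integral_undef h] at hpos
    exact lt_irrefl _ hpos
  obtain ⟨K, hK, hKp, hK0, hKneg⟩ := Biharm.exists_compact m hint hpos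
  have hKne : K.Nonempty := nonempty_of_measure_ne_zero hKp.ne'
  set c : ℝ := T ^ ((1 : ℝ) / 4) with hc
  have hc0 : 0 < c := Real.rpow_pos_of_pos (by linarith) _
  set d : ℝ := Metric.infDist 0 K with hd
  have hd0 : 0 < d := (hK.isClosed.notMem_iff_infDist_pos hKne).mp hK0
  set φ : EuclideanSpace ℝ (Fin (m + 1)) → ℝ := fun z => min 1 (Metric.infDist z K) with hφ
  have hφc : Continuous φ := continuous_const.min (Metric.continuous_infDist_pt K)
  have hφ0 : ∀ z, 0 ≤ φ z := fun z => le_min zero_le_one Metric.infDist_nonneg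
  have hφ1 : ∀ z, φ z ≤ 1 := fun z => min_le_left _ _
  set g : ℕ → EuclideanSpace ℝ (Fin (m + 1)) → ℝ :=
    fun k y => ((k : ℝ) + 1) * φ (-(c⁻¹ • y)) with hg
  have hgmem : ∀ k, memCbeta (m + 1) β (g k) := by
    intro k
    refine ⟨by fun_prop, fun x => mul_nonneg (by positivity) (hφ0 _), ?_, ?_⟩
    · simp only [hg, smul_zero, neg_zero]
      exact mul_pos (by positivity) (lt_min zero_lt_one hd0)
    · have hb : (g k) =O[Filter.comap (fun x : EuclideanSpace ℝ (Fin (m + 1)) => ‖x‖) Filter.atTop]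
          (fun _ => (1 : ℝ)) := by
        refine Asymptotics.IsBigO.of_bound ((k : ℝ) + 1) (Eventually.of_forall fun x => ?_)
        rw [Real.norm_of_nonneg (mul_nonneg (by positivity) (hφ0 _))]
        simp only [norm_one, mul_one]
        exact mul_le_of_le_one_right (by positivity) (hφ1 _)
      refine hb.trans_isLittleO ?_
      rw [Asymptotics.isLittleO_const_left]
      right
      refine tendsto_norm_atTop_atTop.comp ((tendsto_rpow_atTop hβ0).comp tendsto_comap)
  have hgz : ∀ k z, g k (0 - c • z) = ((k : ℝ) + 1) * φ z := by
    intro k z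
    simp only [hg]
    congr 2
    rw [zero_sub, smul_neg, neg_neg, smul_smul, inv_mul_cancel₀ hc0.ne', one_smul]
  have hnz : ∀ z : EuclideanSpace ℝ (Fin (m + 1)), ‖0 - c • z‖ = c * ‖z‖ := by
    intro z
    rw [zero_sub, norm_neg, norm_smul, Real.norm_of_nonneg hc0.le]
  -- uniform lower bound
  set δ : ℝ := min (min 1 (d / 2)) ((c * (d / 2)) ^ β) with hδ
  have hδ0 : 0 < δ := by
    refine lt_min (lt_min one_pos (by positivity)) (by positivity)
  have hlow : ∀ (k : ℕ) z, δ ≤ ((k : ℝ) + 1) * φ z + (c * ‖z‖) ^ β := by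
    intro k z
    have hp : 0 ≤ (c * ‖z‖) ^ β := by positivity
    have hp2 : 0 ≤ ((k : ℝ) + 1) * φ z := mul_nonneg (by positivity) (hφ0 _)
    rcases le_total ‖z‖ (d / 2) with h | h
    · have h1 : d / 2 ≤ Metric.infDist z K := by
        have := Metric.infDist_le_infDist_add_dist (s := K) (x := 0) (y := z)
        rw [dist_zero_left] at this
        linarith
      have h2 : min 1 (d / 2) ≤ φ z := min_le_min le_rfl h1
      have h3 : φ z ≤ ((k : ℝ) + 1) * φ z :=
        le_mul_of_one_le_left (hφ0 _) (by have : (0 : ℝ) ≤ k := by positivity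
                                          linarith)
      have h4 : δ ≤ min 1 (d / 2) := min_le_left _ _
      linarith
    · have h1 : (c * (d / 2)) ^ β ≤ (c * ‖z‖) ^ β := by gcongr
      have h4 : δ ≤ (c * (d / 2)) ^ β := min_le_right _ _
      linarith
  set L : EuclideanSpace ℝ (Fin (m + 1)) → ℝ :=
    K.indicator (fun z => fmn 2 (m + 1) ‖z‖ * (1 / (c * ‖z‖) ^ β)) with hL
  have hlim : Tendsto (fun k : ℕ => ∫ z : EuclideanSpace ℝ (Fin (m + 1)),
      fmn 2 (m + 1) ‖z‖ * (1 / (((k : ℝ) + 1) * φ z + (c * ‖z‖) ^ β))) atTop (𝓝 (∫ z, L z)) := by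
    refine tendsto_integral_of_dominated_convergence (fun z => ‖fmn 2 (m + 1) ‖z‖‖ * (1 / δ)) ?_
      (hint.norm.mul_const _) ?_ ?_
    · intro k
      refine hint.aestronglyMeasurable.mul (Measurable.aestronglyMeasurable ?_)
      have := hφc.measurable
      fun_prop
    · intro k
      refine Eventually.of_forall fun z => ?_
      have h1 := hlow k z
      rw [norm_mul, Real.norm_of_nonneg (r := 1 / _) (by have := hδ0.trans_le h1; positivity)]
      gcongr
    · refine Eventually.of_forall fun z => ?_
      by_cases hz : z ∈ K
      · have h1 : φ z = 0 := by simp [hφ, Metric.infDist_zero_of_mem hz]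
        simp [hL, hz, h1]
      · have h1 : 0 < φ z := lt_min zero_lt_one ((hK.isClosed.notMem_iff_infDist_pos hKne).mp hz)
        simp only [hL, hz, not_false_eq_true, Set.indicator_of_notMem]
        rw [← mul_zero (fmn 2 (m + 1) ‖z‖)]
        refine Tendsto.const_mul _ ?_
        simp only [one_div]
        refine tendsto_inv_atTop_zero.comp ?_
        refine tendsto_atTop_add_const_right _ _ ?_
        refine Tendsto.atTop_mul_const h1 ?_
        exact tendsto_atTop_add_const_right _ _ tendsto_natCast_atTop_atTop
  have hLint : Integrable L := by
    refine Integrable.mono' (hint.norm.mul_const (1 / δ)) ?_ (Eventually.of_forall fun z => ?_)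
    · refine AEStronglyMeasurable.indicator ?_ hK.measurableSet
      refine hint.aestronglyMeasurable.mul (Measurable.aestronglyMeasurable ?_)
      fun_prop
    · by_cases hz : z ∈ K
      · have h1 : φ z = 0 := by simp [hφ, Metric.infDist_zero_of_mem hz]
        have h2 := hlow 0 z
        rw [h1, mul_zero, zero_add] at h2
        simp only [hL, hz, Set.indicator_of_mem]
        rw [norm_mul, Real.norm_of_nonneg (r := 1 / _) (by positivity)]
        gcongr
      · simp only [hL, hz, not_false_eq_true, Set.indicator_of_notMem, norm_zero]
        positivity
  have hLneg : ∀ z ∈ K, L z < 0 := by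
    intro z hz
    simp only [hL, hz, Set.indicator_of_mem]
    have hz0 : z ≠ 0 := fun h => hK0 (h ▸ hz)
    have := norm_pos_iff.mpr hz0
    exact mul_neg_of_neg_of_pos (hKneg z hz) (by positivity)
  have hLpos : 0 < ∫ z, - L z := by
    refine (integral_pos_iff_support_of_nonneg (f := fun z => - L z) ?_ hLint.neg).mpr ?_
    rotate_left
    · refine hKp.trans_le (measure_mono fun z hz => ?_)
      have := hLneg z hz
      simp only [Function.mem_support]
      intro h
      simp at h
      linarith
    · intro z
      by_cases hz : z ∈ K
      · have := hLneg z hz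
        simp only [Pi.zero_apply]
        linarith
      · simp [hL, hz]
  rw [integral_neg] at hLpos
  obtain ⟨k, hk⟩ := (hlim.eventually (gt_mem_nhds (show ∫ z, L z < 0 by linarith))).exists
  refine ⟨g k, hgmem k, 0, ?_⟩
  simp only [hgz, hnz]
  exact mul_neg_of_pos_of_neg hα hk
end
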